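/- arXiv:2510.00290 — 2 statements merged into one kernel-verified Lean document; each statement's English description precedes it below -/
import Mathlib

section
/- Let k be a field of characteristic zero, p a prime number, and F a finitely generated field extension of k with trdeg_k(F) ≥ 1 such that k is relatively algebraically closed in F. Fix an algebraic closure Ω of F, let k̄ be the relative algebraic closure of k in Ω, and let M = F·k̄ be the compositum, i.e. the intermediate field of Ω/F generated by k̄. Let Gal(Ω/F) be the group of field automorphisms of Ω fixing F pointwise with the Krull topology, and Gal(Ω/M) ⊆ Gal(Ω/F) the (closed) subgroup of automorphisms fixing M pointwise, with the subspace topology. Then the image of the restriction map from the set of continuous group homomorphisms Gal(Ω/F) → Z/pZ to the set of continuous group homomorphisms Gal(Ω/M) → Z/pZ (given by restricting a homomorphism to the subgroup Gal(Ω/M)) is an infinite set. -/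
open Polynomial IntermediateField

theorem aux_poly {K Ω ι : Type*} [Field K] [Field Ω] [Algebra K Ω] (t : Ω)
    (ht : Transcendental K t) (S : Finset ι) (r : ι → K) (m : ι → ℕ) (i₀ : ι) (hi₀ : i₀ ∈ S)
    (hr : ∀ i ∈ S, i ≠ i₀ → r i ≠ r i₀) (p : ℕ) (hp0 : p ≠ 0) (hm : ¬ p ∣ m i₀) (c c' : K)
    (hc : ∀ i ∈ S, c + r i₀ ≠ c' + r i) (z : Ω) (hz : z ∈ K⟮t⟯)
    (h : z ^ p * ∏ i ∈ S, (t - algebraMap K Ω (c' + r i)) ^ m i =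
      ∏ i ∈ S, (t - algebraMap K Ω (c + r i)) ^ m i) : False := by
  classical
  have hinj := transcendental_iff_injective.1 ht
  obtain ⟨u, v, rfl⟩ := (mem_adjoin_simple_iff K z).1 hz
  have hne : ∀ x : K, t - algebraMap K Ω x ≠ 0 := by
    intro x hx
    apply ht
    rw [sub_eq_zero.1 hx]
    exact isAlgebraic_algebraMap x
  have hR : ∏ i ∈ S, (t - algebraMap K Ω (c + r i)) ^ m i ≠ 0 :=
    Finset.prod_ne_zero_iff.2 fun i _ => pow_ne_zero _ (hne _)
  have hp : p ≠ 0 → u ≠ 0 ∧ v ≠ 0 := by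
    intro hp
    constructor <;> rintro rfl <;> apply hR <;> rw [← h] <;> simp [hp]
  obtain ⟨hu, hv⟩ := hp hp0
  have hv' : aeval t v ≠ 0 := fun h0 => hv (hinj (by simpa using h0))
  have h2 : u ^ p * ∏ i ∈ S, (X - C (c' + r i)) ^ m i = v ^ p * ∏ i ∈ S, (X - C (c + r i)) ^ m i := by
    apply hinj
    simp only [map_mul, map_pow, map_prod, map_sub, aeval_X, aeval_C]
    rw [← h, div_pow]
    field_simp
  have hX : ∀ d : K, ∏ i ∈ S, (X - C (d + r i)) ^ m i ≠ 0 := fun d =>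
    Finset.prod_ne_zero_iff.2 fun i _ => pow_ne_zero _ (X_sub_C_ne_zero _)
  have h3 := congrArg (rootMultiplicity (c + r i₀)) h2
  have hpow : ∀ w : K[X], w ≠ 0 → rootMultiplicity (c + r i₀) (w ^ p) = p * rootMultiplicity (c + r i₀) w := by
    intro w hw
    rw [← count_roots, ← count_roots, roots_pow, Multiset.count_nsmul]
  rw [rootMultiplicity_mul (mul_ne_zero (pow_ne_zero _ hu) (hX _)),
    rootMultiplicity_mul (mul_ne_zero (pow_ne_zero _ hv) (hX _)), hpow _ hu, hpow _ hv,
    rootMultiplicity_eq_zero (p := ∏ i ∈ S, (X - C (c' + r i)) ^ m i), ← Finset.mul_prod_erase S _ hi₀,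
    rootMultiplicity_mul, rootMultiplicity_X_sub_C_pow,
    rootMultiplicity_eq_zero (p := ∏ i ∈ S.erase i₀, (X - C (c + r i)) ^ m i)] at h3
  · apply hm
    refine (Nat.dvd_add_right (Dvd.intro _ rfl)).1 (⟨_, h3.symm⟩ : p ∣ p * rootMultiplicity (c + r i₀) v + m i₀) 
  · rw [IsRoot.def, eval_prod]
    refine Finset.prod_ne_zero_iff.2 fun i hi => ?_
    rw [eval_pow]
    refine pow_ne_zero _ ?_
    have := hr i (Finset.mem_of_mem_erase hi) (Finset.ne_of_mem_erase hi)
    simp [sub_ne_zero, this.symm]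
  · rw [Finset.mul_prod_erase S (fun i => (X - C (c + r i)) ^ m i) hi₀]; exact hX _
  · rw [IsRoot.def, eval_prod]
    refine Finset.prod_ne_zero_iff.2 fun i hi => ?_
    rw [eval_pow]
    refine pow_ne_zero _ ?_
    have := hc i hi
    simpa [sub_ne_zero] using this

theorem aux_pigeon {K Ω : Type*} [Field K] [CharZero K] [Field Ω] [Algebra K Ω] [IsAlgClosed Ω]
    [Algebra.IsAlgebraic K Ω] (L : IntermediateField K Ω) [FiniteDimensional K L]
    {J : Type*} [Infinite J] (p : ℕ) (hp : 0 < p) (γ : J → Ω) (hγ0 : ∀ c, γ c ≠ 0)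
    (hγL : ∀ c, γ c ∈ L) (hγ : ∀ c, ∃ y : K, γ c ^ p = algebraMap K Ω y) :
    ∃ T : Set J, T.Infinite ∧ ∀ c ∈ T, ∀ c' ∈ T, ∃ y : K, algebraMap K Ω y = γ c / γ c' := by
  have : IsAlgClosure K Ω := ⟨inferInstance, inferInstance⟩
  have : Normal K Ω := IsAlgClosure.normal K Ω
  have : IsGalois K Ω := ⟨⟩
  classical
  have hfin : Finite {x : Ω // x ^ p = 1} := by
    have : {x : Ω | x ^ p = 1}.Finite := by
      refine (Polynomial.nthRoots p (1:Ω)).toFinset.finite_toSet.subset ?_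
      intro x hx
      simpa [Polynomial.mem_nthRoots hp] using hx
    exact this
  let f : J → ((L →ₐ[K] Ω) → {x : Ω // x ^ p = 1}) := fun c τ => ⟨τ ⟨γ c, hγL c⟩ / γ c, by
    obtain ⟨y, hy⟩ := hγ c
    have : (⟨γ c, hγL c⟩ : L) ^ p = algebraMap K L y := Subtype.ext hy
    rw [div_pow, ← map_pow, this, hy, AlgHom.commutes, div_self]
    rw [← hy]; exact pow_ne_zero _ (hγ0 c)⟩
  obtain ⟨y, hy⟩ := Finite.exists_infinite_fiber f
  refine ⟨f ⁻¹' {y}, Set.infinite_coe_iff.1 hy, fun c hc c' hc' => ?_⟩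
  have hcc : f c = f c' := Eq.trans hc (Eq.symm hc')
  apply (InfiniteGalois.mem_range_algebraMap_iff_fixed (k := K) (K := Ω) (γ c / γ c')).2
  intro σ
  have h1 := congrArg Subtype.val (congrFun hcc (σ.toAlgHom.comp L.val))
  simp [f] at h1
  have h0 := hγ0 c
  have h0' := hγ0 c'
  have h0'' : σ (γ c') ≠ 0 := by simpa using h0'
  rw [map_div₀]
  rw [div_eq_div_iff h0 h0'] at h1
  rw [div_eq_div_iff h0'' h0', h1]; ring

theorem aux_mono {A B Ω : Type*} [Field A] [Field B] [Field Ω] [Algebra A Ω] [Algebra B Ω]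
    (h : ∀ a : A, ∃ b : B, algebraMap B Ω b = algebraMap A Ω a) (x : Ω) (hx : IsAlgebraic A x) :
    IsAlgebraic B x := by
  choose f hf using h
  have hinj := (algebraMap B Ω).injective
  let g : A →+* B :=
    { toFun := f
      map_one' := hinj (by rw [hf, map_one, map_one])
      map_zero' := hinj (by rw [hf, map_zero, map_zero])
      map_mul' := fun a b => hinj (by rw [hf, map_mul, map_mul, hf, hf])
      map_add' := fun a b => hinj (by rw [hf, map_add, map_add, hf, hf]) }
  let _ := g.toAlgebra
  have : IsScalarTower A B Ω := IsScalarTower.of_algebraMap_eq fun a => (hf a).symm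
  exact hx.tower_top B

theorem aux_trans {k Ω : Type*} [Field k] [Field Ω] [Algebra k Ω] (t : Ω) (ht : Transcendental k t) :
    ∃ k₁ : IntermediateField k Ω, Transcendental k₁ t ∧ Algebra.IsAlgebraic (k₁⟮t⟯) Ω := by
  have h1 : AlgebraicIndepOn k id ({t} : Set Ω) := by
    exact (algebraicIndependent_singleton_iff (⟨t, rfl⟩ : ({t} : Set Ω))).2 ht
  obtain ⟨B, hB, hBt⟩ := exists_isTranscendenceBasis_superset h1
  have htB : t ∈ B := hB rfl
  refine ⟨IntermediateField.adjoin k (B \ {t}), ?_, ?_⟩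
  · have := hBt.1.transcendental_adjoin (s := {x | x.1 ≠ t}) (i := ⟨t, htB⟩) (by simp)
    have e : (Subtype.val '' {x : B | x.1 ≠ t}) = B \ {t} := by ext; simp; tauto
    rw [e] at this
    intro h
    exact this (IntermediateField.isAlgebraic_adjoin_iff.1 h)
  · have := hBt.isAlgebraic_field
    rw [Subtype.range_coe] at this
    refine ⟨fun x => ?_⟩
    refine aux_mono (A := adjoin k B) ?_ x (this.isAlgebraic x)
    have hk : ∀ b ∈ B, b ≠ t → b ∈ adjoin k (B \ {t}) := fun b hb hbt =>
      subset_adjoin _ _ ⟨hb, hbt⟩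
    generalize adjoin k (B \ {t}) = k₂ at hk ⊢
    have : adjoin k B ≤ (k₂⟮t⟯).restrictScalars k := by
      rw [adjoin_le_iff]
      intro b hb
      by_cases hbt : b = t
      · rw [hbt]
        exact mem_adjoin_simple_self k₂ t
      · exact IntermediateField.algebraMap_mem (k₂⟮t⟯) ⟨b, hk b hb hbt⟩
    exact fun a => ⟨⟨a.1, this a.2⟩, rfl⟩

theorem aux_trans2 {k Ω : Type*} [Field k] [Field Ω] [Algebra k Ω] (t : Ω) (ht : Transcendental k t) :
    ∃ K : IntermediateField k Ω, Transcendental K t ∧ Algebra.IsAlgebraic (K⟮t⟯) Ω ∧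
      ∀ y : Ω, IsAlgebraic k y → y ∈ K := by
  obtain ⟨k₁, h1, h2⟩ := aux_trans t ht
  obtain ⟨K, hK⟩ : ∃ K : IntermediateField k Ω, ∀ x, x ∈ K ↔ IsAlgebraic k₁ x :=
    ⟨(algebraicClosure k₁ Ω).restrictScalars k, fun x => by
      rw [mem_restrictScalars, mem_algebraicClosure_iff]⟩
  have hk₁ : k₁ ≤ K := fun x hx => (hK x).2 (isAlgebraic_algebraMap (⟨x, hx⟩ : k₁))
  refine ⟨K, ?_, ?_, ?_⟩
  · let _ := (inclusion hk₁).toRingHom.toAlgebra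
    have : IsScalarTower k₁ K Ω := IsScalarTower.of_algebraMap_eq fun a => rfl
    have : Algebra.IsAlgebraic k₁ K := ⟨fun x => by
      have := (hK x).1 x.2
      exact (isAlgebraic_algebraMap_iff (algebraMap K Ω).injective).1 this⟩
    exact fun h => h1 (h.restrictScalars k₁)
  · refine ⟨fun x => ?_⟩
    refine aux_mono (A := k₁⟮t⟯) ?_ x (h2.isAlgebraic x)
    intro a
    obtain ⟨r, s, h⟩ := (mem_adjoin_simple_iff k₁ a.1).1 a.2
    refine ⟨⟨a.1, ?_⟩, rfl⟩
    rw [mem_adjoin_simple_iff]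
    refine ⟨r.map (inclusion hk₁).toRingHom, s.map (inclusion hk₁).toRingHom, ?_⟩
    rw [h, aeval_def, aeval_def, aeval_def, aeval_def, eval₂_map, eval₂_map]
    rfl
  · intro y hy
    exact (hK y).2 (hy.tower_top k₁)

theorem aux_hom {F Ω : Type*} [Field F] [Field Ω] [Algebra F Ω] [Algebra.IsAlgebraic F Ω]
    (p : ℕ) (hp : p.Prime) (s : F) (β : Ω → Ω)
    (hβ : ∀ η, IsPrimitiveRoot η p → β η ^ p = algebraMap F Ω s - η)
    (hβ0 : ∀ η, IsPrimitiveRoot η p → β η ≠ 0) :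
    ∃ φ : (Ω ≃ₐ[F] Ω) →* Multiplicative (ZMod p), Continuous φ ∧
      ∀ (ζ : Ω) (m : Ω → ℕ), IsPrimitiveRoot ζ p → (∀ η, IsPrimitiveRoot η p → η ^ m η = ζ) →
      ∀ g : Ω ≃ₐ[F] Ω, (∀ η, IsPrimitiveRoot η p → g η = η) →
        g (∏ η ∈ primitiveRoots p Ω, β η ^ m η) =
          ζ ^ (Multiplicative.toAdd (φ g)).val * ∏ η ∈ primitiveRoots p Ω, β η ^ m η := by
  have hp' : Fact p.Prime := ⟨hp⟩
  have hg : ∀ (g : Ω ≃ₐ[F] Ω) η, IsPrimitiveRoot η p → IsPrimitiveRoot (g η) p := fun g η h =>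
    h.map_of_injective g.injective
  have hval : ∀ (η : Ω), IsPrimitiveRoot η p → ∀ a : ℕ, η ^ ((a : ZMod p)).val = η ^ a := by
    intro η h a
    rw [ZMod.val_natCast, h.eq_orderOf, pow_mod_orderOf]
  have hadd : ∀ (η : Ω), IsPrimitiveRoot η p → ∀ a b : ZMod p, η ^ (a + b).val = η ^ a.val * η ^ b.val := by
    intro η h a b
    rw [← pow_add, ← hval η h (a.val + b.val)]
    simp
  have huniq : ∀ (η : Ω), IsPrimitiveRoot η p → ∀ a b : ZMod p, η ^ a.val = η ^ b.val → a = b := by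
    intro η h a b hab
    exact ZMod.val_injective p (h.pow_inj (ZMod.val_lt a) (ZMod.val_lt b) hab)
  have hex : ∀ (g : Ω ≃ₐ[F] Ω) (η : Ω), ∃ e : ZMod p, IsPrimitiveRoot η p →
      g (β η) = (g η) ^ e.val * β (g η) := by
    intro g η
    by_cases h : IsPrimitiveRoot η p
    swap
    · exact ⟨0, fun h' => absurd h' h⟩
    have h1 := hg g η h
    have h2 : (g (β η) / β (g η)) ^ p = 1 := by
      rw [div_pow, ← map_pow, hβ η h, hβ _ h1, map_sub, AlgEquiv.commutes, div_self]
      rw [← hβ _ h1]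
      exact pow_ne_zero _ (hβ0 _ h1)
    obtain ⟨i, hi, hi'⟩ := h1.eq_pow_of_pow_eq_one h2
    refine ⟨(i : ZMod p), fun _ => ?_⟩
    rw [hval _ h1, hi', div_mul_cancel₀ _ (hβ0 _ h1)]
  choose e he using hex
  have hmul : ∀ g h η, IsPrimitiveRoot η p → e (g * h) η = e h η + e g (h η) := by
    intro g h η hη
    have h1 := hg h η hη
    have h2 := hg g _ h1
    apply huniq _ h2
    apply mul_right_cancel₀ (hβ0 _ h2)
    rw [hadd _ h2, mul_assoc, ← he g _ h1, ← map_pow g (h η) (e h η).val, ← map_mul g, ← he h _ hη]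
    exact (he (g * h) η hη).symm
  have hmem : ∀ η, η ∈ primitiveRoots p Ω ↔ IsPrimitiveRoot η p := fun η =>
    mem_primitiveRoots hp.pos
  let φ : (Ω ≃ₐ[F] Ω) →* Multiplicative (ZMod p) := MonoidHom.mk'
    (fun g => Multiplicative.ofAdd (∑ η ∈ primitiveRoots p Ω, e g η)) (by
      intro g h
      rw [← ofAdd_add]
      congr 1
      rw [Finset.sum_congr rfl (fun η hη => hmul g h η ((hmem η).1 hη)), Finset.sum_add_distrib,
        add_comm]
      congr 1
      refine Finset.sum_bij (fun η _ => h η) ?_ ?_ ?_ ?_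
      · intro η hη
        exact (hmem _).2 (hg h _ ((hmem _).1 hη))
      · intro a _ b _ hab
        exact h.injective hab
      · intro b hb
        exact ⟨h.symm b, (hmem _).2 (hg h.symm _ ((hmem _).1 hb)), by simp⟩
      · intros; rfl)
  have hφ : ∀ g, φ g = Multiplicative.ofAdd (∑ η ∈ primitiveRoots p Ω, e g η) := fun g => rfl
  have hpow : ∀ ζ : Ω, IsPrimitiveRoot ζ p → ∀ g, ζ ^ (Multiplicative.toAdd (φ g)).val =
      ∏ η ∈ primitiveRoots p Ω, ζ ^ (e g η).val := by
    intro ζ hζ g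
    rw [hφ, toAdd_ofAdd, Finset.prod_pow_eq_pow_sum,
      ← hval ζ hζ (∑ η ∈ primitiveRoots p Ω, (e g η).val)]
    simp
  refine ⟨φ, ?_, ?_⟩
  · apply continuous_of_continuousAt_one
    classical
    let T : Finset Ω := primitiveRoots p Ω ∪ (primitiveRoots p Ω).image β
    let E : IntermediateField F Ω := adjoin F (T : Set Ω)
    have : FiniteDimensional F E := finiteDimensional_adjoin
      (fun x _ => (Algebra.IsAlgebraic.isAlgebraic x).isIntegral)
    have hopen := E.fixingSubgroup_isOpen
    refine ContinuousAt.congr (f := fun _ => (1 : Multiplicative (ZMod p))) continuousAt_const ?_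
    filter_upwards [hopen.mem_nhds (one_mem _)] with g hgE
    symm
    have hfix : ∀ x ∈ T, g x = x := fun x hx => hgE ⟨x, subset_adjoin F _ hx⟩
    rw [hφ]
    rw [Finset.sum_eq_zero, ofAdd_zero]
    intro η hη
    have h1 := hfix η (Finset.mem_union_left _ hη)
    have h2 := hfix (β η) (Finset.mem_union_right _ (Finset.mem_image_of_mem _ hη))
    have hη' := (hmem _).1 hη
    have h3 := he g η hη'
    rw [h1, h2] at h3
    apply huniq η hη'
    apply mul_right_cancel₀ (hβ0 _ hη')
    rw [← h3]; simp
  · intro ζ m hζ hm g hgη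
    rw [hpow ζ hζ, map_prod, ← Finset.prod_mul_distrib]
    refine Finset.prod_congr rfl fun η hη => ?_
    have hη' := (hmem _).1 hη
    rw [map_pow, he g η hη', hgη η hη', mul_pow, ← pow_mul, mul_comm (e g η).val, pow_mul, hm η hη']

theorem aux_le {k F Ω : Type*} [Field k] [Field F] [Field Ω]
    [Algebra k F] [Algebra F Ω] [Algebra k Ω] [IsScalarTower k F Ω]
    (G : Set F) (hG : adjoin k G = ⊤) (N : Subfield Ω)
    (hN : ∀ y : Ω, IsAlgebraic k y → y ∈ N) (hGN : ∀ g ∈ G, algebraMap F Ω g ∈ N)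
    (y : Ω) (hy : y ∈ adjoin F {x : Ω | IsAlgebraic k x}) : y ∈ N := by
  have hF : ∀ f : F, algebraMap F Ω f ∈ N := by
    intro f
    have hf : f ∈ adjoin k G := by rw [hG]; trivial
    induction hf using adjoin_induction with
    | mem x hx => exact hGN x hx
    | algebraMap x =>
      rw [← IsScalarTower.algebraMap_apply]
      exact hN _ (isAlgebraic_algebraMap x)
    | add x y _ _ hx hy => rw [map_add]; exact add_mem hx hy
    | inv x _ hx => rw [map_inv₀]; exact inv_mem hx
    | mul x y _ _ hx hy => rw [map_mul]; exact mul_mem hx hy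
  induction hy using adjoin_induction with
  | mem x hx => exact hN x hx
  | algebraMap x => exact hF x
  | add x y _ _ hx hy => exact add_mem hx hy
  | inv x _ hx => exact inv_mem hx
  | mul x y _ _ hx hy => exact mul_mem hx hy



/-!
STATEMENT 0: Let `k` be a field of characteristic zero, `p` a prime, `F` a finitely
generated field extension of `k` with `trdeg_k F ≥ 1` such that `k` is relatively
algebraically closed in `F`.  Fix an algebraic closure `Ω` of `F`, let `k̄` be the
relative algebraic closure of `k` in `Ω` and `M = F·k̄` the intermediate field of `Ω/F`
generated by `k̄`.  Then the image of the restriction map from continuous group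
homomorphisms `Gal(Ω/F) → ℤ/p` to continuous group homomorphisms `Gal(Ω/M) → ℤ/p`
is infinite.  (`Gal(Ω/F) = Ω ≃ₐ[F] Ω` carries the Krull topology, `Gal(Ω/M)` is the
fixing subgroup of `M` with the subspace topology, and `ℤ/p` is discrete.) -/
theorem stmt0 (k F Ω : Type*) [Field k] [Field F] [Field Ω] [CharZero k]
    [Algebra k F] [Algebra F Ω] [Algebra k Ω] [IsScalarTower k F Ω]
    [IsAlgClosure F Ω]
    (hFG : (⊤ : IntermediateField k F).FG)
    (htrdeg : ∃ x : F, Transcendental k x)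
    (hrelclosed : ∀ x : F, IsAlgebraic k x → ∃ y : k, algebraMap k F y = x)
    (p : ℕ) (hp : p.Prime)
    (M : IntermediateField F Ω)
    (hM : M = IntermediateField.adjoin F {x : Ω | IsAlgebraic k x}) :
    Set.Infinite
      { ψ : ↥M.fixingSubgroup →* Multiplicative (ZMod p) |
        Continuous ψ ∧
        ∃ φ : (Ω ≃ₐ[F] Ω) →* Multiplicative (ZMod p),
          Continuous φ ∧ ∀ h : ↥M.fixingSubgroup, ψ h = φ (h : Ω ≃ₐ[F] Ω) } := by
  classical
  have hAC : IsAlgClosed Ω := IsAlgClosure.isAlgClosed F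
  have hAlg : Algebra.IsAlgebraic F Ω := IsAlgClosure.isAlgebraic
  have hF0 : CharZero F := charZero_of_injective_algebraMap (algebraMap k F).injective
  have hΩ0 : CharZero Ω := charZero_of_injective_algebraMap (algebraMap F Ω).injective
  have hnormal : Normal F Ω := IsAlgClosure.normal F Ω
  have hGal : IsGalois F Ω := ⟨⟩
  have hp0 : NeZero p := ⟨hp.ne_zero⟩
  obtain ⟨G, hG⟩ := hFG
  obtain ⟨x, hx⟩ := htrdeg
  obtain ⟨t, htx⟩ : ∃ t, t = algebraMap F Ω x := ⟨_, rfl⟩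
  have ht : Transcendental k t := by
    rw [htx]
    exact (transcendental_algebraMap_iff (algebraMap F Ω).injective).2 hx
  obtain ⟨K, hKt, hKalg, hKk⟩ := aux_trans2 t ht
  have hroot : ∀ η : Ω, IsPrimitiveRoot η p → IsAlgebraic k η := fun η hη =>
    IsAlgebraic.of_pow hp.pos (by rw [hη.pow_eq_one]; exact isAlgebraic_one)
  have hrootK : ∀ η : Ω, IsPrimitiveRoot η p → η ∈ K := fun η hη => hKk η (hroot η hη)
  obtain ⟨ζ, hζ⟩ := HasEnoughRootsOfUnity.exists_primitiveRoot Ω p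
  have hm : ∀ η : Ω, ∃ m : ℕ, IsPrimitiveRoot η p → η ^ m = ζ := by
    intro η
    by_cases h : IsPrimitiveRoot η p
    · obtain ⟨i, _, hi⟩ := h.eq_pow_of_pow_eq_one hζ.pow_eq_one
      exact ⟨i, fun _ => hi⟩
    · exact ⟨0, fun h' => absurd h' h⟩
  choose m hm using hm
  have hmζ : ¬ p ∣ m ζ := by
    intro h
    have h1 := hm ζ hζ
    rw [(hζ.pow_eq_one_iff_dvd _).2 h] at h1
    exact hζ.ne_one hp.one_lt h1.symm
  have hβ : ∀ (c : ℕ) (η : Ω), ∃ b : Ω, b ^ p = algebraMap F Ω (x - c) - η := fun c η =>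
    IsAlgClosed.exists_pow_nat_eq _ hp.pos
  choose β hβ using hβ
  have htne : ∀ y : K, t - algebraMap K Ω y ≠ 0 := by
    intro y hy
    apply hKt
    rw [sub_eq_zero.1 hy]
    exact isAlgebraic_algebraMap y
  have hβ' : ∀ (c : ℕ) (η : Ω) (hη : IsPrimitiveRoot η p),
      β c η ^ p = t - algebraMap K Ω (c + ⟨η, hrootK η hη⟩) := by
    intro c η hη
    rw [hβ, map_sub, map_add, ← htx, map_natCast, map_natCast, sub_sub]
    rfl
  have hβ0 : ∀ (c : ℕ) (η : Ω), IsPrimitiveRoot η p → β c η ≠ 0 := by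
    intro c η hη h
    apply htne (c + ⟨η, hrootK η hη⟩)
    rw [← hβ' c η hη, h, zero_pow hp.ne_zero]
  have hφ := fun c : ℕ => aux_hom p hp (x - c) (β c) (fun η _ => hβ c η) (hβ0 c)
  choose φ hφc hφ using hφ
  have hmem : ∀ η : Ω, η ∈ primitiveRoots p Ω ↔ IsPrimitiveRoot η p := fun η =>
    mem_primitiveRoots hp.pos
  obtain ⟨α, hα⟩ : ∃ α : ℕ → Ω, ∀ c, α c = ∏ η ∈ primitiveRoots p Ω, β c η ^ m η :=
    ⟨_, fun _ => rfl⟩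
  have hα0 : ∀ c, α c ≠ 0 := fun c => by
    rw [hα]
    exact Finset.prod_ne_zero_iff.2 fun η hη => pow_ne_zero _ (hβ0 c η ((hmem η).1 hη))
  let r : Ω → K := fun η => if h : η ∈ K then ⟨η, h⟩ else 0
  have hr : ∀ η, IsPrimitiveRoot η p → algebraMap K Ω (r η) = η := by
    intro η hη
    simp only [r, dif_pos (hrootK η hη)]
    rfl
  have hαp : ∀ c, α c ^ p = ∏ η ∈ primitiveRoots p Ω, (t - algebraMap K Ω (c + r η)) ^ m η := by
    intro c
    rw [hα, ← Finset.prod_pow]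
    refine Finset.prod_congr rfl fun η hη => ?_
    have hη' := (hmem η).1 hη
    rw [← pow_mul, mul_comm, pow_mul, hβ, map_sub, map_add, hr η hη', ← htx, map_natCast,
      map_natCast, sub_sub]
  have hαK : ∀ c, α c ^ p ∈ K⟮t⟯ := by
    intro c
    rw [hαp]
    refine prod_mem fun η _ => pow_mem (sub_mem (mem_adjoin_simple_self K t) ?_) _
    exact IntermediateField.algebraMap_mem _ _
  let L : IntermediateField K⟮t⟯ Ω := adjoin K⟮t⟯ (algebraMap F Ω '' (G : Set F))
  have hLfin : FiniteDimensional K⟮t⟯ L := by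
    have : Finite (algebraMap F Ω '' (G : Set F)) := (G.finite_toSet.image _)
    exact finiteDimensional_adjoin fun y _ => (hKalg.isAlgebraic y).isIntegral
  have hML : ∀ y ∈ M, y ∈ L := by
    intro y hy
    rw [hM] at hy
    refine aux_le (G : Set F) hG L.toSubfield ?_ ?_ y hy
    · intro z hz
      have : z ∈ K⟮t⟯ := IntermediateField.algebraMap_mem K⟮t⟯ ⟨z, hKk z hz⟩
      exact IntermediateField.algebraMap_mem L ⟨z, this⟩
    · intro g hg
      exact subset_adjoin _ _ ⟨g, hg, rfl⟩
  intro hfin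
  let f : ℕ → { ψ : ↥M.fixingSubgroup →* Multiplicative (ZMod p) |
        Continuous ψ ∧
        ∃ φ : (Ω ≃ₐ[F] Ω) →* Multiplicative (ZMod p),
          Continuous φ ∧ ∀ h : ↥M.fixingSubgroup, ψ h = φ (h : Ω ≃ₐ[F] Ω) } := fun c =>
    ⟨(φ c).comp M.fixingSubgroup.subtype, (hφc c).comp continuous_subtype_val, φ c, hφc c,
      fun h => rfl⟩
  have := hfin.to_subtype
  obtain ⟨ψ, hψ⟩ := Finite.exists_infinite_fiber f
  obtain ⟨c₀⟩ : Nonempty (f ⁻¹' {ψ}) := inferInstance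
  have hMfix : ∀ g ∈ M.fixingSubgroup, ∀ y ∈ M, g y = y := fun g hg y hy => hg ⟨y, hy⟩
  have hrootM : ∀ η, IsPrimitiveRoot η p → η ∈ M := by
    intro η hη
    rw [hM]
    exact subset_adjoin _ _ (hroot η hη)
  have hγM : ∀ c : f ⁻¹' {ψ}, α c / α c₀ ∈ M := by
    intro c
    refine (InfiniteGalois.fixedField_fixingSubgroup M).le ?_
    rintro ⟨g, hg⟩
    change g (α c / α c₀) = α c / α c₀
    have h1 := hφ c ζ m hζ (fun η hη => hm η hη) g (fun η hη => hMfix g hg η (hrootM η hη))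
    have h2 := hφ c₀ ζ m hζ (fun η hη => hm η hη) g (fun η hη => hMfix g hg η (hrootM η hη))
    rw [← hα] at h1 h2
    have h3 : φ c g = φ c₀ g := by
      have h4 : f c = f c₀ := Eq.trans c.2 (Eq.symm c₀.2)
      exact DFunLike.congr_fun (congrArg Subtype.val h4) ⟨g, hg⟩
    rw [map_div₀, h1, h2, h3, mul_div_mul_left]
    exact pow_ne_zero _ (hζ.ne_zero hp.ne_zero)
  obtain ⟨T, hT, hTK⟩ := aux_pigeon L p hp.pos (fun c : f ⁻¹' {ψ} => α c / α c₀)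
    (fun c => div_ne_zero (hα0 _) (hα0 _)) (fun c => hML _ (hγM c))
    (fun c => ⟨⟨(α c / α c₀) ^ p, by rw [div_pow]; exact div_mem (hαK _) (hαK _)⟩, rfl⟩)
  obtain ⟨c, hc⟩ := hT.nonempty
  have hbad : {c' : f ⁻¹' {ψ} | (c'.1 : Ω) ∈
      (primitiveRoots p Ω).image (fun η => (c.1 : Ω) + ζ - η)}.Finite := by
    refine Set.Finite.preimage (f := fun c' : f ⁻¹' {ψ} => (c'.1 : Ω)) ?_ (Finset.finite_toSet _)
    intro a _ b _ hab
    exact Subtype.ext (Nat.cast_injective hab)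
  obtain ⟨c', hc', hcc'⟩ := (hT.sdiff hbad).nonempty
  obtain ⟨z, hz⟩ := hTK c hc c' hc'
  have hinj := (algebraMap K Ω).injective
  refine aux_poly t hKt (primitiveRoots p Ω) r m ζ ((hmem ζ).2 hζ) ?_ p hp.ne_zero hmζ
    (c.1 : K) (c'.1 : K) ?_ z.1 z.2 ?_
  · intro η hη hne h
    apply hne
    rw [← hr η ((hmem η).1 hη), ← hr ζ hζ, h]
  · intro η hη h
    apply hcc'
    rw [Set.mem_ofPred_eq, Finset.mem_image]
    refine ⟨η, hη, ?_⟩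
    have h1 := congrArg (algebraMap K Ω) h
    rw [map_add, map_add, hr ζ hζ, hr η ((hmem η).1 hη), map_natCast, map_natCast] at h1
    rw [h1]; ring
  · have hz' : z.1 = α c / α c' := by
      have h0 := hα0 c₀
      have h0' := hα0 c'
      change z.1 = _ at hz
      rw [hz]
      field_simp
    rw [← hαp, ← hαp, hz', div_pow, div_mul_cancel₀]
    exact pow_ne_zero _ (hα0 _)
end

section
/- Let k be a field of characteristic zero and K a finitely generated field extension of k of transcendence degree n ≥ 1 such that k is relatively algebraically closed in K. Let t be a variable, let j ∈ k(t) be an element of the rational function field in one variable with j ∉ k, and let d ≥ 1 be an integer. Then there exist: an element u ∈ K transcendental over k; a k-embedding ε : k(t) → k(u) ⊆ K of fields over k such that the degree [k(u) : ε(k(t))] is finite and at least d; and elements y₂,…,y_n ∈ K such that u, y₂,…,y_n are algebraically independent over k and K is a finite extension of the subfield E = k(u, y₂,…,y_n); with the following property: fixing an algebraic closure Ω of K, letting k̄ be the relative algebraic closure of k in Ω, and setting F_j = k(ε(j)) ⊆ K, every field automorphism of the compositum k̄·K (the intermediate field of Ω generated by k̄ and K) that fixes the compositum k̄·F_j pointwise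 is the identity. -/
theorem deriv_iterate_mul {F L : Type*} [Field F] [Field L] [Algebra F L]
    (D : Derivation F L L) (f g : L) (n : ℕ) :
    (⇑D)^[n] (f * g) = ∑ ij ∈ Finset.HasAntidiagonal.antidiagonal n,
      (n.choose ij.1) • ((⇑D)^[ij.1] g * (⇑D)^[ij.2] f) := by
  induction n with
  | zero => simp [mul_comm]
  | succ n ih =>
    rw [Finset.sum_antidiagonal_choose_succ_nsmul (M := L)
      (fun i j => (⇑D)^[i] g * (⇑D)^[j] f) n]
    rw [Function.iterate_succ_apply', ih, map_sum, ← Finset.sum_add_distrib]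
    refine Finset.sum_congr rfl fun ij hij => ?_
    rw [map_nsmul, Derivation.leibniz, Function.iterate_succ_apply', Function.iterate_succ_apply',
      smul_add]
    simp only [smul_eq_mul]
    rw [mul_comm (D _) ((⇑D)^[ij.2] f)]
    rw [Nat.choose_symm_of_eq_add (Finset.HasAntidiagonal.mem_antidiagonal.mp hij).symm]

theorem wronskian_scale {F L : Type*} [Field F] [Field L] [Algebra F L]
    (D : Derivation F L L) (m : ℕ) (f : L) (g : Fin m → L) :
    (Matrix.of fun (i j : Fin m) => (⇑D)^[i] (f * g j)).det =
      f ^ m * (Matrix.of fun (i j : Fin m) => (⇑D)^[i] (g j)).det := by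
  have h : (Matrix.of fun (i j : Fin m) => (⇑D)^[i] (f * g j)) =
      (Matrix.of fun (i l : Fin m) => if l ≤ i then
        ((i : ℕ).choose l : L) * (⇑D)^[(i : ℕ) - l] f else 0) *
      (Matrix.of fun (i j : Fin m) => (⇑D)^[i] (g j)) := by
    ext i j
    rw [Matrix.mul_apply]
    simp only [Matrix.of_apply]
    rw [deriv_iterate_mul, Finset.Nat.sum_antidiagonal_eq_sum_range_succ_mk]
    have e1 := Fin.sum_univ_eq_sum_range (fun l : ℕ => if l ≤ (i : ℕ) then
        ((i : ℕ).choose l : L) * (⇑D)^[(i : ℕ) - l] f * (⇑D)^[l] (g j) else 0) m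
    have e2 : ∀ l : Fin m, (if l ≤ i then
        ((i : ℕ).choose l : L) * (⇑D)^[(i : ℕ) - l] f else 0) * (⇑D)^[l] (g j) =
        (if (l : ℕ) ≤ (i : ℕ) then
        ((i : ℕ).choose l : L) * (⇑D)^[(i : ℕ) - l] f * (⇑D)^[l] (g j) else 0) := by
      intro l
      by_cases h : (l : ℕ) ≤ (i : ℕ)
      · rw [if_pos h, if_pos (Fin.le_def.mpr h)]
      · rw [if_neg h, if_neg (fun h' => h (Fin.le_def.mp h')), zero_mul]
    rw [Finset.sum_congr rfl (fun l _ => e2 l), e1]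
    symm
    have hsub : Finset.range ((i : ℕ) + 1) ⊆ Finset.range m :=
      Finset.range_subset_range.mpr i.2
    rw [← Finset.sum_subset hsub]
    · refine Finset.sum_congr rfl fun l hl => ?_
      rw [if_pos (by simpa [Nat.lt_succ_iff] using hl)]
      simp only [nsmul_eq_mul]; ring
    · intro l _ hl
      rw [if_neg (by simpa using hl)]
  rw [h, Matrix.det_mul, Matrix.det_of_isLowerTriangular]
  · simp
  · intro i l hil
    have : i < l := hil
    simp [this]

/-- nonvanishing of the Wronskian -/
theorem wronskian_ne_zero {F L : Type*} [Field F] [Field L] [Algebra F L]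
    (D : Derivation F L L) (hD : ∀ a, D a = 0 → a ∈ Set.range (algebraMap F L))
    (m : ℕ) (g : Fin m → L) (hg : LinearIndependent F g) :
    (Matrix.of fun (i j : Fin m) => (⇑D)^[i] (g j)).det ≠ 0 := by
  induction m with
  | zero => simp
  | succ m ih =>
    intro h0
    obtain ⟨a, ha0, ha⟩ := Matrix.exists_mulVec_eq_zero_iff.mpr h0
    have hrel : ∀ i : ℕ, i < m + 1 → ∑ j, a j * (⇑D)^[i] (g j) = 0 := by
      intro i hi
      have := congrFun ha ⟨i, hi⟩
      simpa [Matrix.mulVec, dotProduct, mul_comm] using this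
    have ih' := ih (fun j => g j.castSucc) (hg.comp _ (Fin.castSucc_injective m))
    have key : ∀ b : Fin m → L, (∀ i : ℕ, i < m → ∑ j, b j * (⇑D)^[i] (g j.castSucc) = 0) →
        b = 0 := by
      intro b hb
      by_contra hne
      apply ih'
      apply Matrix.exists_mulVec_eq_zero_iff.mp
      refine ⟨b, hne, ?_⟩
      ext i
      simpa [Matrix.mulVec, dotProduct, mul_comm] using hb i i.2
    have hal : a (Fin.last m) ≠ 0 := by
      intro hz
      apply ha0
      have := key (fun j => a j.castSucc) (fun i hi => by
        have := hrel i (by omega)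
        rw [Fin.sum_univ_castSucc, hz] at this
        simpa using this)
      ext j
      refine Fin.lastCases hz (fun j => congrFun this j) j
    -- normalise
    set c : Fin (m + 1) → L := fun j => a j / a (Fin.last m) with hc
    have hcl : c (Fin.last m) = 1 := div_self hal
    have hrel' : ∀ i : ℕ, i < m + 1 → ∑ j, c j * (⇑D)^[i] (g j) = 0 := by
      intro i hi
      have := hrel i hi
      have e : ∑ j, c j * (⇑D)^[i] (g j) = (∑ j, a j * (⇑D)^[i] (g j)) / a (Fin.last m) := by
        rw [Finset.sum_div]; refine Finset.sum_congr rfl fun j _ => ?_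
        simp only [hc]; ring
      rw [e, this, zero_div]
    have hDc : (fun j : Fin m => D (c j.castSucc)) = 0 := by
      apply key
      intro i hi
      have h1 := congrArg D (hrel' i (by omega))
      rw [map_sum, map_zero] at h1
      have h2 := hrel' (i + 1) (by omega)
      have e : ∀ j, D (c j * (⇑D)^[i] (g j)) =
          D (c j) * (⇑D)^[i] (g j) + c j * (⇑D)^[i + 1] (g j) := by
        intro j
        rw [Derivation.leibniz, Function.iterate_succ_apply']
        simp only [smul_eq_mul]; ring
      rw [Finset.sum_congr rfl (fun j _ => e j), Finset.sum_add_distrib, h2, add_zero,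
        Fin.sum_univ_castSucc, hcl] at h1
      simpa using h1
    have hcF : ∀ j, ∃ b : F, algebraMap F L b = c j := by
      intro j
      refine Fin.lastCases ?_ (fun j => ?_) j
      · exact ⟨1, by rw [hcl, map_one]⟩
      · exact hD _ (congrFun hDc j)
    choose b hb using hcF
    have h0' := hrel' 0 (by omega)
    have : ∑ j, b j • g j = 0 := by
      rw [← h0']
      refine Finset.sum_congr rfl fun j _ => ?_
      rw [Algebra.smul_def, hb]; rfl
    have hb0 := Fintype.linearIndependent_iff.mp hg b this (Fin.last m)
    have := hb (Fin.last m)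
    rw [hb0, hcl, map_zero] at this
    exact zero_ne_one this

/-- membership of iterated derivatives of powers -/
theorem iterate_pow_mem {F L : Type*} [Field F] [Field L] [Algebra F L]
    (D : Derivation F L L) (O : Subring L) (q : L) (hqO : q ∈ O)
    (hq : ∀ b ∈ O, q * D b ∈ O) (z : L) (hz : z ∈ O) (N : ℕ) (i : ℕ) (hi : i ≤ N) :
    ∃ b ∈ O, q ^ (2 * i) * (⇑D)^[i] (z ^ N) = z ^ (N - i) * b := by
  induction i with
  | zero => exact ⟨1, O.one_mem, by simp⟩
  | succ i ih =>
    obtain ⟨b, hb, e⟩ := ih (by omega)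
    obtain ⟨r, hr⟩ : ∃ r, N - i = r + 1 := ⟨N - i - 1, by omega⟩
    have hr' : N - (i + 1) = r := by omega
    rw [hr'] 
    rw [hr] at e
    set w := (⇑D)^[i] (z ^ N)
    rw [Function.iterate_succ_apply']
    have e2 := congrArg D e
    simp only [Derivation.leibniz, Derivation.leibniz_pow, smul_eq_mul, nsmul_eq_mul] at e2
    refine ⟨q * z * (q * D b) + q * ((r + 1 : ℕ) : L) * (q * D z) * b
      - ((2 * i : ℕ) : L) * (q * D q) * z * b, ?_, ?_⟩
    · have hn : ∀ n : ℕ, (n : L) ∈ O := fun n => natCast_mem O n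
      refine O.sub_mem (O.add_mem ?_ ?_) ?_
      · exact O.mul_mem (O.mul_mem hqO hz) (hq _ hb)
      · exact O.mul_mem (O.mul_mem (O.mul_mem hqO (hn _)) (hq _ hz)) hb
      · exact O.mul_mem (O.mul_mem (O.mul_mem (hn _) (hq _ hqO)) hz) hb
    · have e3 : q ^ (2 * i) * D w = z ^ (r + 1) * D b + b * (((r + 1 : ℕ) : L) * (z ^ r * D z))
          - w * (((2 * i : ℕ) : L) * (q ^ (2 * i - 1) * D q)) := by
        rw [← Nat.add_sub_cancel r 1, eq_sub_iff_add_eq]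
        simpa using e2
      have e4 : q * (((2 * i : ℕ) : L) * q ^ (2 * i - 1)) = ((2 * i : ℕ) : L) * q ^ (2 * i) := by
        rcases Nat.eq_zero_or_pos i with h | h
        · simp [h]
        · obtain ⟨s, hs⟩ : ∃ s, 2 * i = s + 1 := ⟨2 * i - 1, by omega⟩
          rw [hs]; simp only [Nat.add_sub_cancel]; ring
      have : q ^ (2 * (i + 1)) * D w = q * q * (q ^ (2 * i) * D w) := by ring
      rw [this, e3]
      have e5 : q * q * (w * (((2 * i : ℕ) : L) * (q ^ (2 * i - 1) * D q))) =
          ((2 * i : ℕ) : L) * (q * D q) * (q ^ (2 * i) * w) := by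
        calc _ = (q * (((2 * i : ℕ) : L) * q ^ (2 * i - 1))) * (q * w * D q) := by ring
          _ = _ := by rw [e4]; ring
      rw [mul_sub, e5, e]; ring

/-- divisibility of the Wronskian of powers -/
theorem wronskian_pow_mem {F L : Type*} [Field F] [Field L] [Algebra F L]
    (D : Derivation F L L) (O : Subring L) (q : L) (hqO : q ∈ O)
    (hq : ∀ b ∈ O, q * D b ∈ O) (m : ℕ) (z : Fin m → L) (hz : ∀ j, z j ∈ O) (N : ℕ)
    (hN : m ≤ N) :
    ∃ b ∈ O, q ^ (2 * m * m) * (Matrix.of fun (i j : Fin m) => (⇑D)^[i] (z j ^ N)).det =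
      (∏ j, z j) ^ (N - m) * b := by
  have H : ∀ i j : Fin m, ∃ b ∈ O, q ^ (2 * m) * (⇑D)^[i] (z j ^ N) = z j ^ (N - m) * b := by
    intro i j
    obtain ⟨b, hb, e⟩ := iterate_pow_mem D O q hqO hq (z j) (hz j) N i (by omega)
    refine ⟨q ^ (2 * m - 2 * i) * z j ^ (m - i) * b,
      O.mul_mem (O.mul_mem (O.pow_mem hqO _) (O.pow_mem (hz j) _)) hb, ?_⟩
    have h1 : q ^ (2 * m) = q ^ (2 * m - 2 * i) * q ^ (2 * (i : ℕ)) := by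
      rw [← pow_add]; congr 1; omega
    have h2 : z j ^ (N - i) = z j ^ (N - m) * z j ^ (m - (i : ℕ)) := by
      rw [← pow_add]; congr 1; omega
    rw [h1, mul_assoc, e, h2]; ring
  choose b hb e using H
  refine ⟨(Matrix.of b).det, ?_, ?_⟩
  · rw [Matrix.det_apply]
    refine O.sum_mem fun s _ => ?_
    rw [Units.smul_def, zsmul_eq_mul]
    exact O.mul_mem (intCast_mem O _) (O.prod_mem fun j _ => hb _ _)
  · have h1 : (Matrix.of fun i j : Fin m => z j ^ (N - m) * b i j).det =
        (∏ j, z j ^ (N - m)) * (Matrix.of b).det :=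
      Matrix.det_mul_row (fun j => z j ^ (N - m)) (Matrix.of b)
    have h2 : (Matrix.of fun i j : Fin m => q ^ (2 * m) * (⇑D)^[i] (z j ^ N)).det =
        (∏ j : Fin m, q ^ (2 * m)) *
          (Matrix.of fun (i j : Fin m) => (⇑D)^[i] (z j ^ N)).det :=
      Matrix.det_mul_row (fun j => q ^ (2 * m)) _
    rw [Finset.prod_pow] at h1
    rw [← h1]
    simp only [e] at h2
    rw [h2]
    simp [← pow_mul]


theorem exists_unit_scaling {L : Type*} [Field L] (O : Subring L) [IsDedekindDomain O]
    [IsFractionRing O L] {m : ℕ} (ζ : Fin (m + 1) → L) (h0 : ζ 0 ≠ 0) :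
    ∃ y : Fin (m + 1) → L, (∀ i j, y i * ζ j ∈ O) ∧ ∑ i, y i * ζ i = 1 := by
  classical
  set I : FractionalIdeal (nonZeroDivisors O) L :=
    FractionalIdeal.spanFinset O Finset.univ ζ with hI
  have hIc : (I : Submodule O L) = Submodule.span O (Set.range ζ) := by
    simp [hI, FractionalIdeal.spanFinset_coe]
  have hI0 : I ≠ 0 := by
    rw [hI, FractionalIdeal.spanFinset_ne_zero]
    exact ⟨0, Finset.mem_univ _, h0⟩
  have h1 : (1 : L) ∈ (I * I⁻¹ : FractionalIdeal (nonZeroDivisors O) L) := by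
    rw [mul_inv_cancel₀ hI0]; exact FractionalIdeal.one_mem_one _
  have key : ∀ x ∈ (I : Submodule O L) * ((I⁻¹ : FractionalIdeal (nonZeroDivisors O) L) :
      Submodule O L), ∃ y : Fin (m + 1) → L, (∀ i, y i ∈ I⁻¹) ∧ ∑ i, y i * ζ i = x := by
    intro x hx
    refine Submodule.mul_induction_on hx ?_ ?_
    · intro a ha b hb
      rw [hIc] at ha
      obtain ⟨c, rfl⟩ := (Submodule.mem_span_range_iff_exists_fun O).mp ha
      refine ⟨fun i => c i • b, fun i => Submodule.smul_mem _ _ hb, ?_⟩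
      rw [Finset.sum_mul]
      refine Finset.sum_congr rfl fun i _ => ?_
      simp only [Algebra.smul_def]; ring
    · intro a b ha hb
      obtain ⟨y, hy, rfl⟩ := ha
      obtain ⟨y', hy', rfl⟩ := hb
      refine ⟨y + y', fun i => Submodule.add_mem _ (hy i) (hy' i), ?_⟩
      simp [add_mul, Finset.sum_add_distrib]
  obtain ⟨y, hy, hs⟩ := key 1 (by
    rw [← FractionalIdeal.coe_mul]; exact h1)
  refine ⟨y, fun i j => ?_, hs⟩
  have := (FractionalIdeal.mem_inv_iff hI0).mp (hy i) (ζ j) (by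
    change ζ j ∈ (I : Submodule O L)
    rw [hIc]; exact Submodule.subset_span ⟨j, rfl⟩)
  obtain ⟨w, hw⟩ := (FractionalIdeal.mem_one_iff _).mp this
  rw [← hw]; exact w.2

theorem mem_of_pow_mul_mem {L : Type*} [Field L] (O : Subring L) {m : ℕ}
    (s : Fin m → L) (hs : ∀ i, s i ∈ O) (h1 : ∑ i, s i = 1) (e : ℕ) (x : L)
    (hx : ∀ i, s i ^ e * x ∈ O) : x ∈ O := by
  set t : Fin m → O := fun i => ⟨s i, hs i⟩
  have ht : Ideal.span (Set.range t) = ⊤ := by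
    rw [Ideal.eq_top_iff_one]
    have : (1 : O) = ∑ i, t i := by
      apply Subtype.ext; simp [t, h1]
    rw [this]
    exact Ideal.sum_mem _ fun i _ => Ideal.subset_span ⟨i, rfl⟩
  have h2 := Ideal.span_pow_eq_top _ ht e
  have h3 : (1 : O) ∈ Ideal.span ((fun x : O => x ^ e) '' Set.range t) := by rw [h2]; trivial
  have : ∀ r ∈ Ideal.span ((fun x : O => x ^ e) '' Set.range t), (r : L) * x ∈ O := by
    intro r hr
    induction hr using Submodule.span_induction with
    | mem r hr =>
      obtain ⟨_, ⟨i, rfl⟩, rfl⟩ := hr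
      simpa [t] using hx i
    | zero => simp
    | add a b _ _ ha hb => simpa [add_mul] using O.add_mem ha hb
    | smul c a _ ha => simpa [mul_assoc] using O.mul_mem c.2 ha
  simpa using this 1 h3

theorem scaled_mem {F L : Type*} [Field F] [Field L] [Algebra F L]
    (D : Derivation F L L) (O : Subring L) (q : L) (hqO : q ∈ O)
    (hq : ∀ b ∈ O, q * D b ∈ O) (m : ℕ) (z : Fin m → L) (N e a b : ℕ)
    (he : N = m + e) (he1 : 1 ≤ e) (hdeg : N * m + a + b = e * (m + 1))
    (Y r s1 s2 : L) (hr : r ≠ 0) (hz0 : ∀ j, z j ≠ 0)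
    (hz : ∀ j, Y * z j ∈ O) (h1 : Y * s1 ∈ O) (h2 : Y * s2 ∈ O) :
    (Y * r) ^ e * (q ^ (2 * m * m) *
      ((Matrix.of fun (i j : Fin m) => (⇑D)^[i] (z j ^ N)).det * (s1 ^ a * s2 ^ b) /
        (r * ∏ j, z j) ^ e)) ∈ O := by
  rcases eq_or_ne Y 0 with hY | hY
  · rw [hY, zero_mul, zero_pow (by omega), zero_mul]; exact O.zero_mem
  obtain ⟨β, hβ, E⟩ := wronskian_pow_mem D O q hqO hq m (fun j => Y * z j) hz N (by omega)
  have hs := wronskian_scale D m (Y ^ N) (fun j => z j ^ N)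
  simp only [mul_pow] at E hs
  rw [hs] at E
  set W := (Matrix.of fun (i j : Fin m) => (⇑D)^[i] (z j ^ N)).det
  have hP : (∏ j, z j) ≠ 0 := Finset.prod_ne_zero_iff.mpr fun j _ => hz0 j
  rw [Finset.prod_mul_distrib] at E
  simp only [Finset.prod_const, Finset.card_univ, Fintype.card_fin] at E
  have hNm : N - m = e := by omega
  rw [hNm] at E
  have : (Y * r) ^ e * (q ^ (2 * m * m) * (W * (s1 ^ a * s2 ^ b) / (r * ∏ j, z j) ^ e)) =
      (Y * s1) ^ a * (Y * s2) ^ b * β := by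
    have hYp : (Y ^ N) ^ m ≠ 0 := pow_ne_zero _ (pow_ne_zero _ hY)
    apply mul_left_cancel₀ hYp
    have hd : (Y ^ N) ^ m * (Y ^ a * Y ^ b) = Y ^ e * (Y ^ m) ^ e := by
      rw [← pow_mul, ← pow_mul, ← pow_add, ← pow_add, ← pow_add]
      congr 1
      rw [← add_assoc, hdeg]; ring
    calc (Y ^ N) ^ m * ((Y * r) ^ e * (q ^ (2 * m * m) * (W * (s1 ^ a * s2 ^ b) /
            (r * ∏ j, z j) ^ e)))
        = Y ^ e * (q ^ (2 * m * m) * ((Y ^ N) ^ m * W)) * (s1 ^ a * s2 ^ b) /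
            (∏ j, z j) ^ e := by
          rw [mul_pow, mul_pow]; field_simp
      _ = (Y ^ e * (Y ^ m) ^ e) * β * (s1 ^ a * s2 ^ b) := by
          rw [E, mul_pow]; field_simp
      _ = _ := by rw [← hd, mul_pow, mul_pow]; ring
  rw [this]
  exact O.mul_mem (O.mul_mem (O.pow_mem h1 _) (O.pow_mem h2 _)) hβ

theorem eta_mem {F L : Type*} [Field F] [Field L] [Algebra F L]
    (D : Derivation F L L) (O : Subring L) [IsDedekindDomain O]
    [IsFractionRing O L] (hFO : ∀ c : F, algebraMap F L c ∈ O) (q : L) (hqO : q ∈ O)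
    (hq : ∀ b ∈ O, q * D b ∈ O) (m : ℕ) (z : Fin m → L) (z0 : L) (N e a b : ℕ)
    (he : N = m + e) (he1 : 1 ≤ e) (hdeg : N * m + a + b = e * (m + 1))
    (h00 : z0 ≠ 0) (hz0 : ∀ j, z j ≠ 0) (c : Fin m → F) (hc : ∀ j, c j ≠ 0)
    (hrel : z0 ^ N = ∑ j, algebraMap F L (c j) * z j ^ N) (j1 : Fin m) :
    q ^ (2 * m * m) *
      ((Matrix.of fun (i j : Fin m) => (⇑D)^[i] (z j ^ N)).det * (z0 ^ a * z j1 ^ b) /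
        (z0 * ∏ j, z j) ^ e) ∈ O := by
  classical
  obtain ⟨y, hy, hsum⟩ := exists_unit_scaling O (Fin.cons z0 z : Fin (m + 1) → L) (by simpa)
  have hy0 : ∀ i, y i * z0 ∈ O := fun i => by simpa using hy i 0
  have hyj : ∀ i j, y i * z j ∈ O := fun i j => by simpa using hy i j.succ
  refine mem_of_pow_mul_mem O (fun i => y i * (Fin.cons z0 z : Fin (m + 1) → L) i)
    (fun i => hy i i) hsum e _ ?_
  intro i
  refine Fin.cases ?_ (fun i => ?_) i
  · exact scaled_mem D O q hqO hq m z N e a b he he1 hdeg (y 0) z0 z0 (z j1) h00 hz0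
      (hyj 0) (hy0 0) (hyj 0 j1)
  · set z' : Fin m → L := Function.update z i z0 with hz'
    have h := scaled_mem D O q hqO hq m z' N e a b he he1 hdeg (y i.succ) (z i) z0 (z j1)
      (hz0 i) (by
        intro j; rcases eq_or_ne j i with rfl | h
        · simpa [hz'] using h00
        · simpa [hz', h] using hz0 j) (by
        intro j; rcases eq_or_ne j i with rfl | h
        · simpa [hz'] using hy0 _
        · simpa [hz', h] using hyj _ j) (hy0 _) (hyj _ j1)
    have hprod : z i * ∏ j, z' j = z0 * ∏ j, z j := by
      rw [hz', Finset.prod_update_of_mem (Finset.mem_univ i),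
        ← Finset.mul_prod_erase Finset.univ z (Finset.mem_univ i), Finset.sdiff_singleton_eq_erase]
      ring
    have hdet : (Matrix.of fun (i j : Fin m) => (⇑D)^[i] (z' j ^ N)).det =
        algebraMap F L (c i) * (Matrix.of fun (i j : Fin m) => (⇑D)^[i] (z j ^ N)).det := by
      have := Matrix.det_updateCol_sum (Matrix.of fun (i j : Fin m) => (⇑D)^[i] (z j ^ N)) i
        (fun j => algebraMap F L (c j))
      rw [smul_eq_mul] at this
      rw [← this]
      congr 1
      ext r s
      have hit : ∀ (n : ℕ), (⇑D)^[n] (z0 ^ N) =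
          ∑ j, algebraMap F L (c j) * (⇑D)^[n] (z j ^ N) := by
        intro n
        induction n with
        | zero => simpa using hrel
        | succ n ih =>
          rw [Function.iterate_succ_apply', ih, map_sum]
          refine Finset.sum_congr rfl fun j _ => ?_
          rw [← Algebra.smul_def, ← Algebra.smul_def, Function.iterate_succ_apply',
            Derivation.map_smul]
      rcases eq_or_ne s i with rfl | h
      · simp [hz', hit]
      · simp [hz', h]
    rw [hprod, hdet] at h
    have h2 := O.mul_mem (hFO (c i)⁻¹) h
    have hcc : algebraMap F L (c i)⁻¹ * algebraMap F L (c i) = 1 := by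
      rw [← map_mul, inv_mul_cancel₀ (hc i), map_one]
    simp only [Fin.cons_succ]
    convert h2 using 1
    set W := (Matrix.of fun (i j : Fin m) => (⇑D)^[i] (z j ^ N)).det
    set P := (z0 * ∏ j, z j) ^ e
    calc _ = (algebraMap F L (c i)⁻¹ * algebraMap F L (c i)) * ((y i.succ * z i) ^ e *
          (q ^ (2 * m * m) * (W * (z0 ^ a * z j1 ^ b) / P))) := by rw [hcc, one_mul]
      _ = _ := by ring


open IntermediateField in
/-- The integral closure of `F[y]` in `L`, as a subring of `L`. -/
noncomputable def chartRing (F : Type*) {L : Type*} [Field F] [Field L] [Algebra F L] (y : L) :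
    Subring L := (integralClosure (Algebra.adjoin F {y}) L).toSubring

theorem adjoin_singleton_pid (F : Type*) {L : Type*} [Field F] [Field L] [Algebra F L] (y : L) :
    IsPrincipalIdealRing (Algebra.adjoin F {y}) := by
  have hs : Function.Surjective ((Polynomial.aeval y : Polynomial F →ₐ[F] L).rangeRestrict) :=
    AlgHom.rangeRestrict_surjective _
  have h := IsPrincipalIdealRing.of_surjective
    (((Polynomial.aeval y : Polynomial F →ₐ[F] L).rangeRestrict).toRingHom) hs
  rw [Algebra.adjoin_singleton_eq_range_aeval]
  exact h

open IntermediateField IntermediateField.algebraAdjoinAdjoin in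
theorem chart_spec {F L : Type*} [Field F] [Field L] [Algebra F L] [CharZero F] (y : L)
    [FiniteDimensional F⟮y⟯ L] :
    IsDedekindDomain (chartRing F y) ∧ IsFractionRing (chartRing F y) L ∧
    (∀ c : F, algebraMap F L c ∈ chartRing F y) ∧
    (∀ x : L, ∃ p ∈ Algebra.adjoin F {y}, p ≠ 0 ∧ p * x ∈ chartRing F y) ∧
    (∀ D : Derivation F L L, ∃ q ∈ chartRing F y, q ≠ 0 ∧
      ∀ b ∈ chartRing F y, q * D b ∈ chartRing F y) := by
  classical
  haveI : CharZero L := charZero_of_injective_algebraMap (algebraMap F L).injective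
  haveI : CharZero F⟮y⟯ := charZero_of_injective_algebraMap (algebraMap F F⟮y⟯).injective
  haveI := adjoin_singleton_pid F y
  set A := Algebra.adjoin F {y} with hA
  have hDed : IsDedekindDomain (integralClosure A L) :=
    integralClosure.isDedekindDomain A F⟮y⟯ L
  have hFrac : IsFractionRing (integralClosure A L) L :=
    integralClosure.isFractionRing_of_finite_extension F⟮y⟯ L
  have hmul : ∀ x : L, ∃ p ∈ A, p ≠ 0 ∧ p * x ∈ chartRing F y := by
    intro x
    have hx : IsAlgebraic A x := by
      have : IsAlgebraic F⟮y⟯ x := Algebra.IsAlgebraic.isAlgebraic x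
      exact (IsFractionRing.isAlgebraic_iff A F⟮y⟯ L).mpr this
    obtain ⟨p, hp, h⟩ := hx.exists_integral_multiple
    refine ⟨p, p.2, fun h => hp (Subtype.ext h), ?_⟩
    rwa [Algebra.smul_def] at h
  have hc : ∀ c : F, algebraMap F L c ∈ chartRing F y := by
    intro c
    exact (integralClosure A L).algebraMap_mem (algebraMap F A c)
  refine ⟨hDed, hFrac, hc, hmul, ?_⟩
  intro D
  have hfin : Module.Finite A (integralClosure A L) :=
    IsIntegralClosure.finite A F⟮y⟯ L (integralClosure A L)
  have hAft : Algebra.FiniteType F A := by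
    rw [← Subalgebra.fg_iff_finiteType]
    exact Subalgebra.fg_adjoin_finset (R := F) {y} |> fun h => by simpa using h
  have hft : Algebra.FiniteType F (integralClosure A L) :=
    Algebra.FiniteType.trans hAft inferInstance
  obtain ⟨s, hs⟩ := hft.out
  have hq : ∃ q ∈ chartRing F y, q ≠ 0 ∧ ∀ b ∈ s, q * D (b : L) ∈ chartRing F y := by
    clear hs
    induction s using Finset.induction_on with
    | empty => exact ⟨1, one_mem _, one_ne_zero, by simp⟩
    | insert b s hb ih =>
      obtain ⟨q, hqO, hq0, hq⟩ := ih
      obtain ⟨p, hpA, hp0, hp⟩ := hmul (D (b : L))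
      have hpO : p ∈ chartRing F y := (integralClosure A L).algebraMap_mem ⟨p, hpA⟩
      refine ⟨q * p, mul_mem hqO hpO, mul_ne_zero hq0 hp0, ?_⟩
      intro x hx
      rcases Finset.mem_insert.mp hx with rfl | hx
      · rw [mul_assoc]; exact mul_mem hqO hp
      · rw [mul_comm q p, mul_assoc]; exact mul_mem hpO (hq x hx)
  obtain ⟨q, hqO, hq0, hq⟩ := hq
  refine ⟨q, hqO, hq0, ?_⟩
  intro b hb
  have hb' : (⟨b, hb⟩ : integralClosure A L) ∈ Algebra.adjoin F (s : Set (integralClosure A L)) := by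
    rw [hs]; trivial
  have : ∀ x ∈ Algebra.adjoin F (s : Set (integralClosure A L)),
      q * D (x : L) ∈ chartRing F y := by
    intro x hx
    induction hx using Algebra.adjoin_induction with
    | mem x hx => exact hq x hx
    | algebraMap r =>
      have : ((algebraMap F (integralClosure A L) r : integralClosure A L) : L) =
        algebraMap F L r := rfl
      rw [this, Derivation.map_algebraMap, mul_zero]; exact zero_mem _
    | add a b _ _ ha hb =>
      have : q * D ((a + b : integralClosure A L) : L) = q * D (a : L) + q * D (b : L) := by
        push_cast; rw [map_add, mul_add]
      rw [this]; exact add_mem ha hb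
    | mul a b _ _ ha hb =>
      have : q * D ((a * b : integralClosure A L) : L) =
          (a : L) * (q * D (b : L)) + (b : L) * (q * D (a : L)) := by
        push_cast; rw [Derivation.leibniz]; simp only [smul_eq_mul]; ring
      rw [this]
      exact add_mem (mul_mem a.2 hb) (mul_mem b.2 ha)
  exact this _ hb'

/-- degree bound -/
theorem degree_bound {F L : Type*} [Field F] [Field L] [Algebra F L] (x : L)
    (hx : Transcendental F x) (p r s : Polynomial F) (hr : r ≠ 0)
    (h : Polynomial.aeval x p * Polynomial.aeval x⁻¹ r = Polynomial.aeval x⁻¹ s) :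
    p.natDegree ≤ r.natDegree := by
  have hx0 : x ≠ 0 := by
    rintro rfl
    exact hx (isAlgebraic_zero)
  rcases eq_or_ne p 0 with rfl | hp
  · simp
  letI : Invertible x := invertibleOfNonzero hx0
  letI : Invertible x⁻¹ := invertibleOfNonzero (inv_ne_zero hx0)
  have key : ∀ r : Polynomial F, Polynomial.aeval x⁻¹ r * x ^ r.natDegree =
      Polynomial.aeval x r.reverse := by
    intro r
    have h1 := Polynomial.eval₂_reverse_mul_pow (algebraMap F L) x⁻¹ r
    rw [invOf_eq_inv, inv_inv] at h1
    rw [Polynomial.aeval_def, Polynomial.aeval_def, ← h1, inv_pow, mul_assoc,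
      inv_mul_cancel₀ (pow_ne_zero _ hx0), mul_one]
  have hinj := transcendental_iff_injective.mp hx
  have e : p * r.reverse * Polynomial.X ^ s.natDegree =
      s.reverse * Polynomial.X ^ r.natDegree := by
    apply hinj
    simp only [map_mul, map_pow, Polynomial.aeval_X]
    rw [← key r, ← key s, ← h]; ring
  have hr' : r.reverse ≠ 0 := by simpa using hr
  have e2 := congrArg Polynomial.natDegree e
  rw [Polynomial.natDegree_mul (mul_ne_zero hp hr') (by simp),
    Polynomial.natDegree_mul hp hr', Polynomial.natDegree_X_pow] at e2
  have h3 : (s.reverse * Polynomial.X ^ r.natDegree).natDegree ≤ s.natDegree + r.natDegree := by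
    refine (Polynomial.natDegree_mul_le).trans ?_
    rw [Polynomial.natDegree_X_pow]
    have := Polynomial.reverse_natDegree_le s
    omega
  omega

open IntermediateField IntermediateField.algebraAdjoinAdjoin in
theorem riemann_roch_finite {F L : Type*} [Field F] [Field L] [Algebra F L] [CharZero F] (x : L)
    (hx : Transcendental F x) [FiniteDimensional F⟮x⟯ L] [FiniteDimensional F⟮x⁻¹⟯ L]
    (g h : L) (hg : g ≠ 0) (hh : h ≠ 0) :
    ∃ B : ℕ, ∀ v : Fin B → L, (∀ i, g * v i ∈ chartRing F x ∧ h * v i ∈ chartRing F x⁻¹) →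
      ¬ LinearIndependent F v := by
  classical
  haveI : CharZero L := charZero_of_injective_algebraMap (algebraMap F L).injective
  haveI : CharZero F⟮x⟯ := charZero_of_injective_algebraMap (algebraMap F F⟮x⟯).injective
  obtain ⟨-, -, -, hm1, -⟩ := chart_spec (F := F) x
  obtain ⟨-, -, -, hm2, -⟩ := chart_spec (F := F) x⁻¹
  haveI := adjoin_singleton_pid F x
  haveI := adjoin_singleton_pid F x⁻¹
  set b0 := Module.finBasis F⟮x⟯ L
  set n := Module.finrank F⟮x⟯ L
  choose p1 hp1A hp1 hp1O using fun j => hm1 (g⁻¹ * b0 j)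
  choose p2 hp2A hp2 hp2O using fun j => hm2 (h⁻¹ * (p1 j * b0 j))
  have hr : ∀ j, ∃ r : Polynomial F, Polynomial.aeval x⁻¹ r = p2 j := by
    intro j
    have := hp2A j
    rw [Algebra.adjoin_singleton_eq_range_aeval] at this
    exact this
  choose r hr using hr
  set c := ∑ j, (r j).natDegree with hcdef
  -- the finite dimensional target
  set S : Submodule F L := (Polynomial.degreeLE F (c : WithBot ℕ)).map
    (Polynomial.aeval x : Polynomial F →ₐ[F] L).toLinearMap with hS
  haveI : FiniteDimensional F (Polynomial.degreeLE F (c : WithBot ℕ)) := by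
    rw [Polynomial.degreeLE_eq_span_X_pow]
    exact FiniteDimensional.span_finset F _
  haveI : FiniteDimensional F S := inferInstance
  set T : L →ₗ[F] (Fin n → L) := LinearMap.pi fun j =>
    ((IsScalarTower.toAlgHom F F⟮x⟯ L).toLinearMap).comp
      (((Algebra.trace F⟮x⟯ L).restrictScalars F).comp (LinearMap.mulRight F (p1 j * b0 j))) with hT
  have hTapp : ∀ w j, T w j = ((Algebra.trace F⟮x⟯ L (w * (p1 j * b0 j)) : F⟮x⟯) : L) := by
    intro w j; rfl
  have hTinj : Function.Injective T := by
    rw [← LinearMap.ker_eq_bot, LinearMap.ker_eq_bot']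
    intro w hw
    have hnd := traceForm_nondegenerate F⟮x⟯ L
    refine hnd.1 w ?_
    intro w'
    rw [← b0.sum_repr w', map_sum]
    refine Finset.sum_eq_zero fun j _ => ?_
    rw [map_smul]
    have h1 := congrFun hw j
    rw [hTapp] at h1
    have h2 : Algebra.trace F⟮x⟯ L (w * (p1 j * b0 j)) = 0 := Subtype.ext h1
    have hp1F : p1 j ∈ F⟮x⟯ := algebra_adjoin_le_adjoin F {x} (hp1A j)
    have h3 : w * (p1 j * b0 j) = (⟨p1 j, hp1F⟩ : F⟮x⟯) • (w * b0 j) := by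
      rw [Algebra.smul_def]; change _ = p1 j * _; ring
    rw [h3, map_smul, smul_eq_mul, mul_eq_zero] at h2
    rcases h2 with h2 | h2
    · exact absurd (congrArg Subtype.val h2) (hp1 j)
    · rw [Algebra.traceForm_apply, h2, smul_zero]
  have hmem : ∀ w, g * w ∈ chartRing F x → h * w ∈ chartRing F x⁻¹ → ∀ j, T w j ∈ S := by
    intro w h1 h2 j
    rw [hTapp]
    set τ := Algebra.trace F⟮x⟯ L (w * (p1 j * b0 j)) with hτ
    have i1 : IsIntegral (Algebra.adjoin F {x}) (w * (p1 j * b0 j)) := by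
      have : w * (p1 j * b0 j) = (g * w) * (p1 j * (g⁻¹ * b0 j)) := by field_simp
      rw [this]
      exact (mul_mem h1 (hp1O j) : _ ∈ chartRing F x)
    have i2 : IsIntegral (Algebra.adjoin F {x}) τ := Algebra.isIntegral_trace i1
    obtain ⟨P, hP⟩ := IsIntegrallyClosed.isIntegral_iff.mp i2
    have hadjx : ∀ y a : L, a ∈ Algebra.adjoin F {y} → ∃ p : Polynomial F,
        Polynomial.aeval y p = a := by
      intro y a ha
      rw [Algebra.adjoin_singleton_eq_range_aeval] at ha
      exact ha
    obtain ⟨P', hP'⟩ := hadjx x P.1 P.2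
    have hτL : (τ : L) = Polynomial.aeval x P' := by
      rw [← hP]; exact hP'.symm
    -- at infinity
    have hadj : ∀ a ∈ Algebra.adjoin F {x⁻¹}, a ∈ F⟮x⟯ := by
      intro a ha
      have hle : Algebra.adjoin F {x⁻¹} ≤ F⟮x⟯.toSubalgebra :=
        Algebra.adjoin_le (by
          rintro _ rfl
          exact (inv_mem (mem_adjoin_simple_self F x) : x⁻¹ ∈ F⟮x⟯))
      exact hle ha
    letI : Algebra (Algebra.adjoin F {x⁻¹}) F⟮x⟯ :=
      (Subalgebra.inclusion (show Algebra.adjoin F {x⁻¹} ≤ F⟮x⟯.toSubalgebra from hadj)).toAlgebra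
    haveI : IsScalarTower (Algebra.adjoin F {x⁻¹}) F⟮x⟯ L := IsScalarTower.of_algebraMap_eq
      fun _ => rfl
    have i3 : IsIntegral (Algebra.adjoin F {x⁻¹}) (p2 j * (w * (p1 j * b0 j))) := by
      have : p2 j * (w * (p1 j * b0 j)) = (h * w) * (p2 j * (h⁻¹ * (p1 j * b0 j))) := by
        field_simp
      rw [this]
      exact (mul_mem h2 (hp2O j) : _ ∈ chartRing F x⁻¹)
    have i4 := Algebra.isIntegral_trace (L := F⟮x⟯) i3
    have e1 : Algebra.trace F⟮x⟯ L (p2 j * (w * (p1 j * b0 j))) =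
        (⟨p2 j, hadj _ (hp2A j)⟩ : F⟮x⟯) * τ := by
      have : p2 j * (w * (p1 j * b0 j)) = (⟨p2 j, hadj _ (hp2A j)⟩ : F⟮x⟯) •
        (w * (p1 j * b0 j)) := by rw [Algebra.smul_def]; rfl
      rw [this, map_smul, smul_eq_mul]
    rw [e1] at i4
    have i5 : IsIntegral (Algebra.adjoin F {x⁻¹}) (p2 j * (τ : L)) := i4.map
      (IsScalarTower.toAlgHom (Algebra.adjoin F {x⁻¹}) F⟮x⟯ L)
    have i5m : p2 j * (τ : L) ∈ F⟮x⁻¹⟯ := by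
      refine mul_mem (algebra_adjoin_le_adjoin F _ (hp2A j)) ?_
      have hle : F⟮x⟯ ≤ F⟮x⁻¹⟯ := by
        rw [adjoin_simple_le_iff]
        have := inv_mem (mem_adjoin_simple_self F x⁻¹)
        rwa [inv_inv] at this
      exact hle τ.2
    have i6 : IsIntegral (Algebra.adjoin F {x⁻¹}) (⟨_, i5m⟩ : F⟮x⁻¹⟯) := by
      refine (isIntegral_algHom_iff (IsScalarTower.toAlgHom (Algebra.adjoin F {x⁻¹}) F⟮x⁻¹⟯ L)
        (RingHom.injective _)).mp ?_
      exact i5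
    obtain ⟨Q, hQ⟩ := IsIntegrallyClosed.isIntegral_iff.mp i6
    obtain ⟨Q', hQ'⟩ := hadjx x⁻¹ Q.1 Q.2
    have hQL : Polynomial.aeval x P' * Polynomial.aeval x⁻¹ (r j) = Polynomial.aeval x⁻¹ Q' := by
      rw [hr j, ← hτL, mul_comm]
      have := congrArg Subtype.val hQ
      exact this.symm.trans hQ'.symm
    have hdeg := degree_bound x hx P' (r j) Q' (by
      intro h0; apply hp2 j; rw [← hr j, h0, map_zero]) hQL
    rw [hS, Submodule.mem_map]
    refine ⟨P', ?_, hτL.symm⟩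
    rw [Polynomial.mem_degreeLE]
    refine (Polynomial.degree_le_natDegree).trans ?_
    have : (r j).natDegree ≤ c :=
      Finset.single_le_sum (f := fun j => (r j).natDegree) (fun _ _ => Nat.zero_le _)
        (Finset.mem_univ j)
    exact_mod_cast hdeg.trans this
  refine ⟨Module.finrank F (Fin n → S) + 1, fun v hv hli => ?_⟩
  have hli2 : LinearIndependent F (fun i => T (v i)) :=
    hli.map' T (LinearMap.ker_eq_bot.mpr hTinj)
  set ι : (Fin n → S) →ₗ[F] (Fin n → L) := LinearMap.pi fun j => S.subtype.comp (LinearMap.proj j)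
  have hli3 : LinearIndependent F
      (fun i => (fun j => ⟨T (v i) j, hmem (v i) (hv i).1 (hv i).2 j⟩ : Fin n → S)) := by
    apply LinearIndependent.of_comp ι
    exact hli2
  have := hli3.fintype_card_le_finrank
  simp at this


open IntermediateField in
theorem isAlgebraic_of_transcendental_one {F L : Type*} [Field F] [Field L] [Algebra F L]
    (h1 : Algebra.trdeg F L ≤ 1) (a : L) (ha : Transcendental F a) :
    Algebra.IsAlgebraic F⟮a⟯ L := by
  have hai : AlgebraicIndependent F (fun _ : Unit => a) :=
    algebraicIndependent_unique_type_iff.mpr ha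
  have hb : IsTranscendenceBasis F (fun _ : Unit => a) := by
    refine hai.isTranscendenceBasis_of_lift_trdeg_le_of_finite ?_
    simpa using h1
  have := hb.isAlgebraic_field
  rwa [show Set.range (fun _ : Unit => a) = {a} by simp] at this

open IntermediateField in
theorem exists_derivation {F L : Type u} [Field F] [Field L] [Algebra F L] [CharZero F]
    [Algebra.EssFiniteType F L] (h1 : Algebra.trdeg F L ≤ 1)
    (x : L) (hx : Transcendental F x)
    (hcl : ∀ a : L, IsAlgebraic F a → a ∈ Set.range (algebraMap F L)) :
    ∃ D : Derivation F L L, ∀ a, D a = 0 → a ∈ Set.range (algebraMap F L) := by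
  have hnon : ∃ D : Derivation F L L, D ≠ 0 := by
    by_contra hcon
    push Not at hcon
    have hsub : Subsingleton (Ω[L⁄F]) := by
      by_contra hns
      rw [not_subsingleton_iff_nontrivial] at hns
      obtain ⟨w, hw⟩ := exists_ne (0 : Ω[L⁄F])
      obtain ⟨f, hw'⟩ : ∃ f : Module.Dual L (Ω[L⁄F]), f w ≠ 0 := by
        by_contra hall
        push Not at hall
        exact hw ((Module.forall_dual_apply_eq_zero_iff L w).mp hall)
      have h0 := hcon (f.compDer (KaehlerDifferential.D F L))
      have hf0 : f = 0 := by
        apply (KaehlerDifferential.linearMapEquivDerivation F L).injective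
        rw [map_zero]
        exact h0
      rw [hf0] at hw'
      exact hw' rfl
    have hu : Algebra.FormallyUnramified F L := ⟨hsub⟩
    have hs := (Algebra.FormallyUnramified.iff_isSeparable F L).mp hu
    exact hx (Algebra.IsAlgebraic.isAlgebraic x)
  obtain ⟨D, hD⟩ := hnon
  refine ⟨D, fun a ha => ?_⟩
  by_contra hna
  have hat : Transcendental F a := fun h => hna (hcl a h)
  have := isAlgebraic_of_transcendental_one h1 a hat
  have : CharZero F⟮a⟯ := charZero_of_injective_algebraMap (algebraMap F F⟮a⟯).injective
  have : Algebra.FormallyUnramified F⟮a⟯ L := Algebra.FormallyUnramified.of_isSeparable _ _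
  have hz : ∀ b ∈ F⟮a⟯, D b = 0 := by
    intro b hb
    induction hb using IntermediateField.adjoin_induction with
    | mem x hx => rw [Set.mem_singleton_iff.mp hx]; exact ha
    | algebraMap x => simp
    | add x y _ _ hx hy => rw [map_add, hx, hy, add_zero]
    | inv x _ hx => rw [Derivation.leibniz_inv, hx, smul_zero]
    | mul x y _ _ hx hy => rw [Derivation.leibniz, hx, hy]; simp
  let D' : Derivation F⟮a⟯ L L :=
    { toFun := D
      map_add' := map_add D
      map_smul' := by
        intro c y
        rw [Algebra.smul_def, Derivation.leibniz]
        change (c : L) • D y + y • D (c : L) = _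
        rw [hz _ c.2]
        simp [Algebra.smul_def]
      map_one_eq_zero' := D.map_one_eq_zero
      leibniz' := D.leibniz }
  have h0 : D' = 0 := by
    have : Subsingleton (Derivation F⟮a⟯ L L) :=
      (KaehlerDifferential.linearMapEquivDerivation F⟮a⟯ L).symm.injective.subsingleton
    exact Subsingleton.elim _ _
  apply hD
  ext y
  exact congrArg (fun d : Derivation F⟮a⟯ L L => d y) h0

open IntermediateField in
theorem power_sum_core {F L : Type u} [Field F] [Field L] [Algebra F L] [CharZero F]
    [Algebra.EssFiniteType F L] (h1 : Algebra.trdeg F L ≤ 1)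
    (x : L) (hx : Transcendental F x)
    (hcl : ∀ a : L, IsAlgebraic F a → a ∈ Set.range (algebraMap F L)) (m : ℕ) :
    ∃ N0 : ℕ, ∀ N ≥ N0, ∀ (z0 : L) (z : Fin m → L), z0 ≠ 0 → (∀ j, z j ≠ 0) →
      (∀ j, z0 / z j ∉ Set.range (algebraMap F L)) →
      LinearIndependent F (fun j => z j ^ N) →
      ∀ c : Fin m → F, (∀ j, c j ≠ 0) → z0 ^ N ≠ ∑ j, algebraMap F L (c j) * z j ^ N := by
  obtain ⟨D, hD⟩ := exists_derivation h1 x hx hcl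
  have hxi : Transcendental F x⁻¹ := fun h => hx (by simpa using h.inv)
  have := isAlgebraic_of_transcendental_one h1 x hx
  have := isAlgebraic_of_transcendental_one h1 _ hxi
  have : Algebra.EssFiniteType F⟮x⟯ L := Algebra.EssFiniteType.of_comp F _ _
  have : Algebra.EssFiniteType F⟮x⁻¹⟯ L := Algebra.EssFiniteType.of_comp F _ _
  have : FiniteDimensional F⟮x⟯ L := Algebra.finite_of_essFiniteType_of_isAlgebraic
  have : FiniteDimensional F⟮x⁻¹⟯ L := Algebra.finite_of_essFiniteType_of_isAlgebraic
  obtain ⟨i1, i2, hF1, -, hq1⟩ := chart_spec (F := F) x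
  obtain ⟨i3, i4, hF2, -, hq2⟩ := chart_spec (F := F) x⁻¹
  obtain ⟨q, hqO, hq0, hq⟩ := hq1 D
  obtain ⟨q', hqO', hq0', hq'⟩ := hq2 D
  obtain ⟨B, hB⟩ := riemann_roch_finite x hx (q ^ (2 * m * m)) (q' ^ (2 * m * m))
    (pow_ne_zero _ hq0) (pow_ne_zero _ hq0')
  refine ⟨B + m * m + m + 1, fun N hN z0 z h00 hz0 hrat hli c hc hrel => ?_⟩
  rcases Nat.eq_zero_or_pos m with rfl | hm
  · simp at hrel
    exact h00 hrel.1
  set j1 : Fin m := ⟨0, hm⟩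
  obtain ⟨e, he⟩ : ∃ e, N = m + e := ⟨N - m, by omega⟩
  obtain ⟨E, hE⟩ : ∃ E, e = m * m + E := ⟨e - m * m, by omega⟩
  have hEB : B ≤ E := by omega
  set W := (Matrix.of fun (i j : Fin m) => (⇑D)^[i] (z j ^ N)).det with hW
  have hW0 : W ≠ 0 := wronskian_ne_zero D hD m _ hli
  have hdeg : ∀ i : Fin B, N * m + (i : ℕ) + (E - i) = e * (m + 1) := by
    intro i
    have h1 : (i : ℕ) + (E - i) = E := by omega
    rw [add_assoc, h1, he, hE]; ring
  refine hB (fun i => W * (z0 ^ (i : ℕ) * z j1 ^ (E - i)) / (z0 * ∏ j, z j) ^ e) ?_ ?_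
  · intro i
    exact ⟨eta_mem D (chartRing F x) hF1 q hqO hq m z z0 N e i (E - i) he (by omega) (hdeg i)
        h00 hz0 c hc hrel j1,
      eta_mem D (chartRing F x⁻¹) hF2 q' hqO' hq' m z z0 N e i (E - i) he (by omega) (hdeg i)
        h00 hz0 c hc hrel j1⟩
  · set r := z0 / z j1 with hr
    have hrt : Transcendental F r := fun h => hrat j1 (hcl _ h)
    set C := W * z j1 ^ E / (z0 * ∏ j, z j) ^ e with hC
    have hC0 : C ≠ 0 := by
      refine div_ne_zero (mul_ne_zero hW0 (pow_ne_zero _ (hz0 _))) (pow_ne_zero _ ?_)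
      exact mul_ne_zero h00 (Finset.prod_ne_zero_iff.mpr fun j _ => hz0 j)
    have hv : (fun i : Fin B => W * (z0 ^ (i : ℕ) * z j1 ^ (E - i)) / (z0 * ∏ j, z j) ^ e) =
        fun i : Fin B => LinearMap.mulLeft F C (r ^ (i : ℕ)) := by
      funext i
      have h2 : z j1 ^ E = z j1 ^ (E - i) * z j1 ^ (i : ℕ) := by
        rw [← pow_add]; congr 1; omega
      rw [LinearMap.mulLeft_apply, hC, hr, h2, div_pow]
      have h3 := pow_ne_zero (i : ℕ) (hz0 j1)
      field_simp
    rw [hv]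
    have hp : LinearIndependent F (fun i : ℕ => r ^ i) := by
      have h4 := (Polynomial.basisMonomials F).linearIndependent.map'
        (Polynomial.aeval r : Polynomial F →ₐ[F] L).toLinearMap
        (LinearMap.ker_eq_bot.mpr (transcendental_iff_injective.mp hrt))
      convert! h4 using 1
      funext i
      simp [Polynomial.aeval_monomial]
    have hp2 : LinearIndependent F (fun i : Fin B => r ^ (i : ℕ)) :=
      hp.comp _ Fin.val_injective
    refine hp2.map' (LinearMap.mulLeft F C) (LinearMap.ker_eq_bot.mpr ?_)
    intro a b hab
    exact mul_left_cancel₀ hC0 hab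


/-- Proportionality over the subfield `F`. -/
def projSetoid (F L : Type*) [Field F] [Field L] [Algebra F L] : Setoid L where
  r z z' := ∃ c : F, c ≠ 0 ∧ z' = algebraMap F L c * z
  iseqv :=
    { refl := fun z => ⟨1, one_ne_zero, by simp⟩
      symm := by
        rintro z z' ⟨c, hc, rfl⟩
        refine ⟨c⁻¹, inv_ne_zero hc, ?_⟩
        rw [← mul_assoc, ← map_mul, inv_mul_cancel₀ hc, map_one, one_mul]
      trans := by
        rintro z z' z'' ⟨c, hc, rfl⟩ ⟨c', hc', rfl⟩
        exact ⟨c' * c, mul_ne_zero hc' hc, by rw [map_mul]; ring⟩ }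

theorem projSetoid_of_div {F L : Type*} [Field F] [Field L] [Algebra F L] {z z' : L}
    (hz : z ≠ 0) (hz' : z' ≠ 0) (h : z / z' ∈ Set.range (algebraMap F L)) :
    (projSetoid F L).r z' z := by
  obtain ⟨c, hc⟩ := h
  refine ⟨c, ?_, ?_⟩
  · rintro rfl
    rw [map_zero] at hc
    exact div_ne_zero hz hz' hc.symm
  · rw [hc]; field_simp

open IntermediateField in
theorem power_linearIndep {F L : Type u} [Field F] [Field L] [Algebra F L] [CharZero F]
    [Algebra.EssFiniteType F L] (h1 : Algebra.trdeg F L ≤ 1)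
    (x : L) (hx : Transcendental F x)
    (hcl : ∀ a : L, IsAlgebraic F a → a ∈ Set.range (algebraMap F L)) (M : ℕ) :
    ∃ N0 : ℕ, ∀ N ≥ N0, ∀ T : Finset L, T.card ≤ M → (∀ z ∈ T, z ≠ 0) →
      (∀ z ∈ T, ∀ z' ∈ T, (projSetoid F L).r z z' → z = z') →
      LinearIndepOn F (fun z : L => z ^ N) (T : Set L) := by
  classical
  choose N0 hN0 using fun m => power_sum_core h1 x hx hcl m
  refine ⟨(Finset.range (M + 1)).sup N0, fun N hN T => ?_⟩
  induction T using Finset.induction_on with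
  | empty => intro _ _ _; simp
  | insert z0 T hz0 ih =>
    intro hcard hne hpr
    have hli := ih (by rw [Finset.card_insert_of_notMem hz0] at hcard; omega)
      (fun z hz => hne z (Finset.mem_insert_of_mem hz))
      (fun z hz z' hz' => hpr z (Finset.mem_insert_of_mem hz) z' (Finset.mem_insert_of_mem hz'))
    rw [Finset.coe_insert, linearIndepOn_insert (by simpa using hz0)]
    refine ⟨hli, fun hmem => ?_⟩
    rw [Submodule.mem_span_image_finset_iff_exists_fun] at hmem
    obtain ⟨c', hc'⟩ := hmem
    obtain ⟨c, hc⟩ : ∃ c : L → F, ∑ i ∈ T, c i • i ^ N = z0 ^ N := by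
      refine ⟨fun y => if h : y ∈ T then c' ⟨y, h⟩ else 0, ?_⟩
      rw [← hc', ← Finset.sum_coe_sort T]
      exact Finset.sum_congr rfl fun i _ => by simp
    set S := T.filter (fun z => c z ≠ 0) with hS
    have hST : S ⊆ T := Finset.filter_subset _ _
    have hsum : z0 ^ N = ∑ z ∈ S, algebraMap F L (c z) * z ^ N := by
      rw [← hc, hS, Finset.sum_filter_of_ne]
      · simp [Algebra.smul_def]
      · intro z _ h h0
        apply h
        rw [h0, map_zero, zero_mul]
    set eq := S.equivFin.symm
    refine hN0 S.card N (le_trans (Finset.le_sup (f := N0) (Finset.mem_range.mpr ?_)) hN) z0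
      (fun i => (eq i : L)) (hne _ (Finset.mem_insert_self _ _))
      (fun i => hne _ (Finset.mem_insert_of_mem (hST (eq i).2))) ?_ ?_ (fun i => c (eq i)) ?_ ?_
    · have := Finset.card_le_card hST
      rw [Finset.card_insert_of_notMem hz0] at hcard
      omega
    · intro i hi
      have hm := hST (eq i).2
      have := hpr _ (Finset.mem_insert_of_mem hm) _ (Finset.mem_insert_self _ _)
        (projSetoid_of_div (hne _ (Finset.mem_insert_self _ _))
          (hne _ (Finset.mem_insert_of_mem hm)) hi)
      rw [← this] at hz0
      exact hz0 hm
    · have h2 : LinearIndepOn F (fun z : L => z ^ N) (S : Set L) :=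
        hli.mono (by exact_mod_cast hST)
      exact LinearIndependent.comp h2 eq eq.injective
    · intro i
      exact (Finset.mem_filter.mp (eq i).2).2
    · rw [hsum, ← Finset.sum_coe_sort S]
      exact (Equiv.sum_comp eq (fun z : S => algebraMap F L (c z) * (z : L) ^ N)).symm

open IntermediateField Classical in
theorem class_sum_one {F L : Type u} [Field F] [Field L] [Algebra F L] [CharZero F]
    [Algebra.EssFiniteType F L] (h1 : Algebra.trdeg F L ≤ 1)
    (x : L) (hx : Transcendental F x)
    (hcl : ∀ a : L, IsAlgebraic F a → a ∈ Set.range (algebraMap F L)) (ι : Type*) (M : ℕ) :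
    ∃ N0 : ℕ, ∀ N ≥ N0, ∀ (s : Finset ι) (z : ι → L) (a : ι → F), s.card ≤ M →
      (∀ i ∈ s, z i ≠ 0) → ∑ i ∈ s, algebraMap F L (a i) * z i ^ N = 0 →
      ∀ i ∈ s, ∑ i' ∈ s with (projSetoid F L).r (z i) (z i'),
        algebraMap F L (a i') * z i' ^ N = 0 := by
  obtain ⟨N0, hN0⟩ := power_linearIndep h1 x hx hcl M
  refine ⟨N0, fun N hN s z a hs hne hsum => ?_⟩
  set ρ : L → L := fun y => (Quotient.mk (projSetoid F L) y).out with hρ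
  have hρ1 : ∀ y, (projSetoid F L).r (ρ y) y := fun y => Quotient.mk_out (s := projSetoid F L) y
  have hρ2 : ∀ y y', (projSetoid F L).r y y' ↔ ρ y = ρ y' := by
    intro y y'
    constructor
    · intro h
      have : Quotient.mk (projSetoid F L) y = Quotient.mk _ y' := Quotient.sound h
      simp only [hρ, this]
    · intro h
      refine (projSetoid F L).iseqv.trans ((projSetoid F L).iseqv.symm (hρ1 y)) ?_
      rw [h]; exact hρ1 y'
  choose f hf0 hf using hρ1
  set T := s.image (fun i => ρ (z i)) with hT
  have hli := hN0 N hN T (Finset.card_image_le.trans hs) (by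
      intro y hy
      obtain ⟨i, hi, rfl⟩ := Finset.mem_image.mp hy
      intro h0
      apply hne i hi
      rw [hf (z i), h0, mul_zero]) (by
      intro y hy y' hy' h
      obtain ⟨i, hi, rfl⟩ := Finset.mem_image.mp hy
      obtain ⟨i', hi', rfl⟩ := Finset.mem_image.mp hy'
      rw [← hρ2]
      refine (projSetoid F L).iseqv.trans ((projSetoid F L).iseqv.symm ⟨_, hf0 _, hf _⟩)
        ((projSetoid F L).iseqv.trans h ⟨_, hf0 _, hf _⟩))
  have hcls : ∀ t, ∑ i ∈ s with ρ (z i) = t, algebraMap F L (a i) * z i ^ N =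
      (∑ i ∈ s with ρ (z i) = t, a i * f (z i) ^ N) • t ^ N := by
    intro t
    rw [Finset.sum_smul]
    refine Finset.sum_congr rfl fun i hi => ?_
    have h2 := (Finset.mem_filter.mp hi).2
    rw [Algebra.smul_def, map_mul, map_pow, ← h2, mul_assoc, ← mul_pow, ← hf]
  have hsum2 : ∑ t ∈ T, (∑ i ∈ s with ρ (z i) = t, a i * f (z i) ^ N) • t ^ N = 0 := by
    rw [← hsum, ← Finset.sum_fiberwise_of_maps_to (g := fun i => ρ (z i)) (t := T)
      (fun i hi => Finset.mem_image_of_mem _ hi)]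
    exact Finset.sum_congr rfl fun t _ => (hcls t).symm
  rw [linearIndepOn_finset_iff] at hli
  intro i hi
  have h0 := hli _ hsum2 (ρ (z i)) (Finset.mem_image_of_mem _ hi)
  have h4 := hcls (ρ (z i))
  rw [h0, zero_smul] at h4
  rw [← h4]
  refine Finset.sum_congr ?_ fun _ _ => rfl
  ext i'
  simp only [Finset.mem_filter, hρ2]
  constructor
  · rintro ⟨h, h'⟩; exact ⟨h, h'.symm⟩
  · rintro ⟨h, h'⟩; exact ⟨h, h'.symm⟩


open IntermediateField IntermediateField.algebraAdjoinAdjoin in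
theorem isAlgebraic_adjoin_iff' {C L : Type*} [Field C] [Field L] [Algebra C L] (s : Set L) (a : L) :
    IsAlgebraic (Algebra.adjoin C s) a ↔ IsAlgebraic (adjoin C s) a := by
  exact IsFractionRing.isAlgebraic_iff (Algebra.adjoin C s) (adjoin C s) L

/-- The field of elements algebraic over all the coordinates except the `i`th. -/
abbrev coordField {C L : Type*} [Field C] [Field L] [Algebra C L] {n : ℕ} (x : Fin n → L)
    (i : Fin n) : IntermediateField C L :=
  (algebraicClosure (IntermediateField.adjoin C (x '' {i}ᶜ)) L).restrictScalars C

theorem mem_coordField {C L : Type*} [Field C] [Field L] [Algebra C L] {n : ℕ} (x : Fin n → L)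
    (i : Fin n) (a : L) :
    a ∈ coordField (C := C) x i ↔ IsAlgebraic (Algebra.adjoin C (x '' {i}ᶜ)) a := by
  rw [IntermediateField.mem_restrictScalars, mem_algebraicClosure_iff, isAlgebraic_adjoin_iff']

theorem coordField_inter {C L : Type*} [Field C] [Field L] [Algebra C L] {n : ℕ} (hn : 1 ≤ n)
    (x : Fin n → L) (hx : AlgebraicIndependent C x) (a : L)
    (ha : ∀ i, a ∈ coordField (C := C) x i) : IsAlgebraic C a := by
  have : Nonempty (Fin n) := ⟨⟨0, hn⟩⟩
  have hI : (AlgebraicIndependent.matroid C L).Indep (Set.range x) :=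
    AlgebraicIndependent.matroid_indep_iff.mpr hx.to_subtype_range
  have h := hI.closure_iInter_eq_biInter_closure_of_forall_subset (Js := fun i => x '' {i}ᶜ)
    (fun i => Set.image_subset_range _ _)
  have h0 : (⋂ i, x '' {i}ᶜ) = (∅ : Set L) := by
    rw [Set.eq_empty_iff_forall_notMem]
    intro y hy
    rw [Set.mem_iInter] at hy
    obtain ⟨i, -, rfl⟩ := hy ⟨0, hn⟩
    obtain ⟨i', hi', he⟩ := hy i
    exact hi' (hx.injective he)
  have h1 : a ∈ (AlgebraicIndependent.matroid C L).closure (⋂ i, x '' {i}ᶜ) := by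
    rw [h, Set.mem_iInter]
    intro i
    rw [AlgebraicIndependent.matroid_closure_eq]
    exact (mem_coordField x i a).mp (ha i)
  rw [h0, AlgebraicIndependent.matroid_closure_eq] at h1
  have h2 : IsAlgebraic (Algebra.adjoin C (∅ : Set L)) a := h1
  rw [isAlgebraic_adjoin_iff', IntermediateField.adjoin_empty] at h2
  exact h2.restrictScalars C

theorem coordField_transcendental {C L : Type*} [Field C] [Field L] [Algebra C L] {n : ℕ}
    (x : Fin n → L) (hx : AlgebraicIndependent C x) (i : Fin n) :
    Transcendental (coordField (C := C) x i) (x i) := by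
  have := hx.transcendental_adjoin (s := {i}ᶜ) (i := i) (by simp)
  rw [Transcendental, isAlgebraic_adjoin_iff'] at this
  exact Transcendental.algebraicClosure this

theorem coordField_closed {C L : Type*} [Field C] [Field L] [Algebra C L] {n : ℕ}
    (x : Fin n → L) (i : Fin n) (a : L) (ha : IsAlgebraic (coordField (C := C) x i) a) :
    a ∈ Set.range (algebraMap (coordField (C := C) x i) L) := by
  have h : a ∈ coordField (C := C) x i := by
    rw [IntermediateField.mem_restrictScalars, mem_algebraicClosure_iff]
    have ha' : IsAlgebraic (algebraicClosure (IntermediateField.adjoin C (x '' {i}ᶜ)) L) a := ha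
    exact ha'.restrictScalars _
  exact ⟨⟨a, h⟩, rfl⟩

theorem isAlgebraic_of_range_le {R R' A : Type*} [CommRing R] [CommRing R'] [CommRing A]
    [Algebra R A] [Algebra R' A] (hi : Function.Injective (algebraMap R A))
    (hi' : Function.Injective (algebraMap R' A))
    (h : ∀ r : R, algebraMap R A r ∈ (algebraMap R' A).range) (a : A) (ha : IsAlgebraic R a) :
    IsAlgebraic R' a := by
  let eqv : R' ≃+* (algebraMap R' A).range := RingEquiv.ofBijective (algebraMap R' A).rangeRestrict
    ⟨fun b c hbc => hi' (congrArg Subtype.val hbc), (algebraMap R' A).rangeRestrict_surjective⟩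
  let f : R →+* R' := eqv.symm.toRingHom.comp ((algebraMap R A).codRestrict _ h)
  have hf : ∀ r, algebraMap R' A (f r) = algebraMap R A r := fun r =>
    congrArg Subtype.val (eqv.apply_symm_apply ((algebraMap R A).codRestrict _ h r))
  let : Algebra R R' := f.toAlgebra
  have : IsScalarTower R R' A := IsScalarTower.of_algebraMap_eq fun r => (hf r).symm
  refine ha.extendScalars fun b c hbc => hi ?_
  rw [← hf, ← hf]
  exact congrArg _ hbc

theorem adjoin_range_subset {C L : Type*} [Field C] [Field L] [Algebra C L] {n : ℕ}
    (x : Fin n → L) (i : Fin n) (E : IntermediateField C L)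
    (hE : ∀ l, l ≠ i → x l ∈ E) (a : L) (ha : a ∈ Algebra.adjoin C (Set.range x)) :
    a ∈ Algebra.adjoin E {x i} := by
  induction ha using Algebra.adjoin_induction with
  | mem y hy =>
    obtain ⟨l, rfl⟩ := hy
    by_cases hl : l = i
    · rw [hl]
      exact Algebra.self_mem_adjoin_singleton _ _
    · exact Subalgebra.algebraMap_mem (Algebra.adjoin E {x i}) (⟨x l, hE l hl⟩ : E)
  | algebraMap r => exact Subalgebra.algebraMap_mem (Algebra.adjoin E {x i}) (algebraMap C E r)
  | add y z _ _ hy hz => exact add_mem hy hz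
  | mul y z _ _ hy hz => exact mul_mem hy hz

theorem trdeg_le_one_of_mem {C L : Type*} [Field C] [Field L] [Algebra C L] {n : ℕ}
    (x : Fin n → L) (hx : IsTranscendenceBasis C x) (i : Fin n) (E : IntermediateField C L)
    (hE : ∀ l, l ≠ i → x l ∈ E) : Algebra.trdeg E L ≤ 1 := by
  have halg : Algebra.IsAlgebraic (Algebra.adjoin E {x i}) L := by
    have h1 := hx.isAlgebraic
    refine ⟨fun a => isAlgebraic_of_range_le (R := Algebra.adjoin C (Set.range x))
      Subtype.val_injective Subtype.val_injective (fun r => ?_) a (h1.isAlgebraic a)⟩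
    exact ⟨⟨r.1, adjoin_range_subset x i E hE r.1 r.2⟩, rfl⟩
  have := Algebra.IsAlgebraic.trdeg_le_cardinalMk E {x i}
  rwa [Cardinal.mk_singleton] at this

theorem coordField_trdeg {C L : Type*} [Field C] [Field L] [Algebra C L] {n : ℕ}
    (x : Fin n → L) (hx : IsTranscendenceBasis C x) (i : Fin n) :
    Algebra.trdeg (coordField (C := C) x i) L ≤ 1 := by
  refine trdeg_le_one_of_mem x hx i _ fun l hl => ?_
  rw [mem_coordField]
  exact isAlgebraic_algebraMap
    (⟨x l, Algebra.subset_adjoin ⟨l, hl, rfl⟩⟩ : Algebra.adjoin C (x '' {i}ᶜ))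

open Classical in
theorem class_sum {C : Type*} {L : Type u} [Field C] [Field L] [Algebra C L] [CharZero C]
    [Algebra.EssFiniteType C L] {n : ℕ} (hn : 1 ≤ n)
    (x : Fin n → L) (hx : IsTranscendenceBasis C x)
    (hcl : ∀ a : L, IsAlgebraic C a → a ∈ Set.range (algebraMap C L)) (ι : Type*) (M : ℕ) :
    ∃ N0 : ℕ, ∀ N ≥ N0, ∀ (s : Finset ι) (z : ι → L) (a : ι → C), s.card ≤ M →
      (∀ i ∈ s, z i ≠ 0) → ∑ i ∈ s, algebraMap C L (a i) * z i ^ N = 0 →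
      ∀ i ∈ s, ∑ i' ∈ s with (projSetoid C L).r (z i) (z i'),
        algebraMap C L (a i') * z i' ^ N = 0 := by
  have key : ∀ l : Fin n, ∃ N0 : ℕ, ∀ N ≥ N0, ∀ (s : Finset ι) (z : ι → L) (a : ι → C),
      s.card ≤ M → (∀ i ∈ s, z i ≠ 0) → ∑ i ∈ s, algebraMap C L (a i) * z i ^ N = 0 →
      ∀ i ∈ s, ∑ i' ∈ s with (projSetoid (coordField (C := C) x l) L).r (z i) (z i'),
        algebraMap C L (a i') * z i' ^ N = 0 := by
    intro l
    have : CharZero (coordField (C := C) x l) :=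
      charZero_of_injective_algebraMap (algebraMap C (coordField (C := C) x l)).injective
    have : Algebra.EssFiniteType (coordField (C := C) x l) L := Algebra.EssFiniteType.of_comp C _ _
    obtain ⟨N0, hN0⟩ := class_sum_one (coordField_trdeg x hx l) (x l)
      (coordField_transcendental x hx.1 l) (coordField_closed x l) ι M
    refine ⟨N0, fun N hN s z a => ?_⟩
    have := hN0 N hN s z (fun i => algebraMap C (coordField (C := C) x l) (a i))
    simpa only [← IsScalarTower.algebraMap_apply] using this
  choose N0 hN0 using key
  refine ⟨Finset.univ.sup N0, fun N hN s z a => ?_⟩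
  have hN0' := fun l => hN0 l N (le_trans (Finset.le_sup (f := N0) (Finset.mem_univ l)) hN)
  induction s using Finset.strongInduction with
  | H s ih =>
    intro hs hne hsum i hi
    by_cases hall : ∀ i0 ∈ s, ∀ i1 ∈ s, (projSetoid C L).r (z i0) (z i1)
    · rw [Finset.filter_true_of_mem (fun i' hi' => hall i hi i' hi')]
      exact hsum
    · push Not at hall
      obtain ⟨i0, hi0, i1, hi1, hnp⟩ := hall
      obtain ⟨l, hl⟩ : ∃ l, z i1 / z i0 ∉ coordField (C := C) x l := by
        by_contra hcon
        push Not at hcon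
        exact hnp (projSetoid_of_div (hne _ hi1) (hne _ hi0)
          (hcl _ (coordField_inter hn x hx.1 _ hcon)))
      have hsub : (s.filter fun i' => (projSetoid (coordField (C := C) x l) L).r (z i) (z i')) ⊂ s := by
        refine (Finset.filter_ssubset).mpr ?_
        by_contra hcon
        push Not at hcon
        have h01 := (projSetoid (coordField (C := C) x l) L).iseqv.trans
          ((projSetoid (coordField (C := C) x l) L).iseqv.symm (hcon i0 hi0)) (hcon i1 hi1)
        obtain ⟨c, -, hc⟩ := h01
        apply hl
        rw [hc, mul_div_assoc, div_self (hne _ hi0), mul_one]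
        exact c.2
      have h2 := hN0' l s z a hs hne hsum i hi
      have h3 := ih _ hsub ((Finset.card_le_card hsub.1).trans hs)
        (fun i' hi' => hne i' (hsub.1 hi')) h2 i
        (Finset.mem_filter.mpr ⟨hi, (projSetoid (coordField (C := C) x l) L).iseqv.refl _⟩)
      rw [← h3]
      refine Finset.sum_congr ?_ fun _ _ => rfl
      ext i'
      simp only [Finset.mem_filter]
      constructor
      · rintro ⟨h, c, hc, hc'⟩
        refine ⟨⟨h, algebraMap C _ c, (map_ne_zero _).mpr hc, ?_⟩, c, hc, hc'⟩
        rw [← IsScalarTower.algebraMap_apply]; exact hc'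
      · rintro ⟨⟨h, -⟩, h'⟩; exact ⟨h, h'⟩


/-- Proportionality over `C`. -/
def PropTo (C : Type*) {L : Type*} [Field C] [Field L] [Algebra C L] (z z' : L) : Prop :=
  (projSetoid C L).r z z'

namespace PropTo

variable {C L : Type*} [Field C] [Field L] [Algebra C L]

theorem symm {z z' : L} (h : PropTo C z z') : PropTo C z' z := (projSetoid C L).iseqv.symm h

theorem trans {z z' z'' : L} (h : PropTo C z z') (h' : PropTo C z' z'') : PropTo C z z'' :=
  (projSetoid C L).iseqv.trans h h'

theorem pow {z z' : L} (h : PropTo C z z') (m : ℕ) : PropTo C (z ^ m) (z' ^ m) := by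
  obtain ⟨c, hc, rfl⟩ := h
  exact ⟨c ^ m, pow_ne_zero _ hc, by rw [mul_pow, map_pow]⟩

theorem map {z z' : L} (h : PropTo C z z') (σ : L ≃ₐ[C] L) : PropTo C (σ z) (σ z') := by
  obtain ⟨c, hc, rfl⟩ := h
  exact ⟨c, hc, by simp⟩

theorem root (hcl : ∀ a : L, IsAlgebraic C a → a ∈ Set.range (algebraMap C L)) {y z : L}
    (hy : y ≠ 0) (hz : z ≠ 0) {m : ℕ} (hm : 1 ≤ m) (h : PropTo C (y ^ m) (z ^ m)) :
    PropTo C y z := by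
  obtain ⟨c, hc, h⟩ := h
  refine projSetoid_of_div hz hy (hcl _ ?_)
  refine IsAlgebraic.of_pow hm ?_
  rw [div_pow, h, mul_div_assoc, div_self (pow_ne_zero _ hy), mul_one]
  exact isAlgebraic_algebraMap c

theorem pow_eq {y : L} (hy : Transcendental C y) {m m' : ℕ}
    (h : PropTo C (y ^ m) (y ^ m')) : m = m' := by
  obtain ⟨c, hc, h⟩ := h
  have h2 : Polynomial.aeval y (Polynomial.X ^ m' : Polynomial C) =
      Polynomial.aeval y (Polynomial.C c * Polynomial.X ^ m) := by
    simpa using h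
  have h3 := transcendental_iff_injective.mp hy h2
  have h4 := congrArg Polynomial.natDegree h3
  rw [Polynomial.natDegree_X_pow, Polynomial.natDegree_C_mul_X_pow _ _ hc] at h4
  exact h4.symm

end PropTo

theorem prop_of_power_relations {C L : Type*} [Field C] [Field L] [Algebra C L]
    (hcl : ∀ a : L, IsAlgebraic C a → a ∈ Set.range (algebraMap C L))
    (u : L) (hu : Transcendental C u) (σ : L ≃ₐ[C] L) (d : ℕ)
    (h : ∀ r : ℕ, ∃ α β : ℕ, 1 ≤ α ∧ α ≤ d ∧ 1 ≤ β ∧ β ≤ d ∧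
      PropTo C (u ^ β) ((σ ^ r) u ^ α)) : PropTo C u (σ u) := by
  have hu0 : u ≠ 0 := by rintro rfl; exact hu isAlgebraic_zero
  have hσ0 : ∀ r : ℕ, (σ ^ r) u ≠ 0 := fun r => (map_ne_zero _).mpr hu0
  choose α β hα1 hαd hβ1 hβd hab using h
  obtain ⟨r1, r2, hne, heq⟩ : ∃ r1 r2 : ℕ, r1 ≠ r2 ∧
      (fun r => ((⟨α r, by have := hαd r; omega⟩, ⟨β r, by have := hβd r; omega⟩) :
        Fin (d + 1) × Fin (d + 1))) r1 = (fun r => (⟨α r, by have := hαd r; omega⟩,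
          ⟨β r, by have := hβd r; omega⟩)) r2 := by
    obtain ⟨r1, r2, h1, h2⟩ := Finite.exists_ne_map_eq_of_infinite
      (fun r => ((⟨α r, by have := hαd r; omega⟩, ⟨β r, by have := hβd r; omega⟩) :
        Fin (d + 1) × Fin (d + 1)))
    exact ⟨r1, r2, h1, h2⟩
  have hαe : α r1 = α r2 := congrArg (fun p => (p.1 : ℕ)) heq
  have hβe : β r1 = β r2 := congrArg (fun p => (p.2 : ℕ)) heq
  -- a power of σ multiplies u by a constant
  obtain ⟨s, hs1, hs⟩ : ∃ s : ℕ, 1 ≤ s ∧ PropTo C u ((σ ^ s) u) := by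
    have aux : ∀ r r' : ℕ, r < r' → α r = α r' → β r = β r' →
        ∃ s : ℕ, 1 ≤ s ∧ PropTo C u ((σ ^ s) u) := by
      intro r r' hlt e1 e2
      refine ⟨r' - r, by omega, ?_⟩
      have h1 := (hab r).symm.trans (e2 ▸ hab r')
      rw [← e1] at h1
      refine PropTo.root hcl hu0 (hσ0 _) (hα1 r) ?_
      have h2 := h1.map (σ ^ r)⁻¹
      have e3 : (σ ^ r') = σ ^ r * σ ^ (r' - r) := by rw [← pow_add]; congr 1; omega
      rw [e3, map_pow, map_pow] at h2
      have e4 : ∀ y, (σ ^ r)⁻¹ ((σ ^ r) y) = y := fun y => (σ ^ r).symm_apply_apply y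
      rw [AlgEquiv.mul_apply, e4, e4] at h2
      exact h2
    rcases lt_or_gt_of_ne hne with hlt | hlt
    · exact aux _ _ hlt hαe hβe
    · exact aux _ _ hlt hαe.symm hβe.symm
  have hit : ∀ m : ℕ, PropTo C (u ^ (β 1 ^ m)) ((σ ^ m) u ^ (α 1 ^ m)) := by
    intro m
    induction m with
    | zero =>
      simp only [pow_zero, pow_one]
      exact (projSetoid C L).iseqv.refl u
    | succ m ih =>
      have h1 := ih.pow (β 1)
      have h2 := ((hab 1).map (σ ^ m)).pow (α 1 ^ m)
      rw [← pow_mul, ← pow_mul] at h1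
      rw [map_pow, map_pow, ← pow_mul, ← pow_mul, ← AlgEquiv.mul_apply, ← pow_add] at h2
      rw [mul_comm (β 1)] at h2
      rw [pow_succ, pow_succ (α 1), mul_comm (α 1 ^ m) (α 1)]
      exact h1.trans (by convert! h2 using 2)
  have h3 := (hit s).trans (hs.symm.pow _)
  have h4 := PropTo.pow_eq hu h3
  have h5 : β 1 = α 1 := Nat.pow_left_injective (by omega) h4
  have h6 := hab 1
  rw [h5, pow_one] at h6
  exact PropTo.root hcl hu0 (by simpa using hσ0 1) (hα1 1) h6

open Classical in
/-- The class sum property at exponent `N` for relations with at most `M` terms. -/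
def CSAt (C L : Type*) [Field C] [Field L] [Algebra C L] (ι : Type*) (M N : ℕ) : Prop :=
  ∀ (s : Finset ι) (z : ι → L) (a : ι → C), s.card ≤ M →
      (∀ i ∈ s, z i ≠ 0) → ∑ i ∈ s, algebraMap C L (a i) * z i ^ N = 0 →
      ∀ i ∈ s, ∑ i' ∈ s with PropTo C (z i) (z i'),
        algebraMap C L (a i') * z i' ^ N = 0

theorem CSAt.exists_other {C L : Type*} [Field C] [Field L] [Algebra C L] {ι : Type*} {M N : ℕ}
    (h : CSAt C L ι M N) (s : Finset ι) (z : ι → L) (a : ι → C) (hs : s.card ≤ M)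
    (hne : ∀ i ∈ s, z i ≠ 0) (hsum : ∑ i ∈ s, algebraMap C L (a i) * z i ^ N = 0)
    (i : ι) (hi : i ∈ s) (hai : a i ≠ 0) : ∃ i' ∈ s, i' ≠ i ∧ PropTo C (z i) (z i') := by
  classical
  by_contra hcon
  push Not at hcon
  have h1 := h s z a hs hne hsum i hi
  rw [Finset.sum_eq_single i] at h1
  · exact mul_ne_zero ((map_ne_zero _).mpr hai) (pow_ne_zero _ (hne i hi)) h1
  · intro i' hi' hii
    rw [Finset.mem_filter] at hi'
    exact absurd hi'.2 (hcon i' hi'.1 hii)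
  · intro hn
    exact absurd (Finset.mem_filter.mpr ⟨hi, (projSetoid C L).iseqv.refl _⟩) hn

theorem CSAt.two_terms {C L : Type*} [Field C] [Field L] [Algebra C L] {ι : Type*} {M N : ℕ}
    (h : CSAt C L ι M N) (s : Finset ι) (z : ι → L) (a : ι → C) (hs : s.card ≤ M)
    (hne : ∀ i ∈ s, z i ≠ 0) (hsum : ∑ i ∈ s, algebraMap C L (a i) * z i ^ N = 0)
    (i i' : ι) (hi : i ∈ s) (hi' : i' ∈ s) (hii : i ≠ i') (hp : PropTo C (z i) (z i'))
    (huniq : ∀ l ∈ s, PropTo C (z i) (z l) → l = i ∨ l = i') :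
    algebraMap C L (a i) * z i ^ N + algebraMap C L (a i') * z i' ^ N = 0 := by
  classical
  have h1 := h s z a hs hne hsum i hi
  have h2 : (s.filter fun l => PropTo C (z i) (z l)) = {i, i'} := by
    ext l
    simp only [Finset.mem_filter, Finset.mem_insert, Finset.mem_singleton]
    constructor
    · rintro ⟨hl, hpl⟩; exact huniq l hl hpl
    · rintro (rfl | rfl)
      · exact ⟨hi, (projSetoid C L).iseqv.refl _⟩
      · exact ⟨hi', hp⟩
  rw [h2, Finset.sum_pair hii] at h1
  exact h1

theorem power_relation {C L : Type*} [Field C] [Field L] [Algebra C L]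
    (u : L) (hu : Transcendental C u) (d N : ℕ) (hd : 1 ≤ d)
    (hCS : CSAt C L (ℕ × ℕ) ((d + 1) * (d + 1)) N)
    (A B : Polynomial C) (hA : A.natDegree ≤ d) (hB : B.natDegree ≤ d)
    (hAB : A.coeff d * B.coeff 0 - A.coeff 0 * B.coeff d ≠ 0)
    (σ : L ≃ₐ[C] L)
    (hσ : Polynomial.aeval (σ u ^ N) A * Polynomial.aeval (u ^ N) B =
      Polynomial.aeval (u ^ N) A * Polynomial.aeval (σ u ^ N) B) :
    ∃ α β : ℕ, 1 ≤ α ∧ α ≤ d ∧ 1 ≤ β ∧ β ≤ d ∧ PropTo C (u ^ β) (σ u ^ α) := by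
  have hu0 : u ≠ 0 := by rintro rfl; exact hu isAlgebraic_zero
  have hσu : Transcendental C (σ u) := by
    intro h
    exact hu ((isAlgebraic_algHom_iff σ.toAlgHom σ.injective).mp h)
  have hσ0 : σ u ≠ 0 := (map_ne_zero _).mpr hu0
  have hsum : ∑ p ∈ Finset.range (d + 1) ×ˢ Finset.range (d + 1),
      algebraMap C L (A.coeff p.1 * B.coeff p.2 - A.coeff p.2 * B.coeff p.1) *
        (σ u ^ p.1 * u ^ p.2) ^ N = 0 := by
    rw [Polynomial.aeval_eq_sum_range' (Nat.lt_succ_of_le hA),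
      Polynomial.aeval_eq_sum_range' (Nat.lt_succ_of_le hB),
      Polynomial.aeval_eq_sum_range' (Nat.lt_succ_of_le hA),
      Polynomial.aeval_eq_sum_range' (Nat.lt_succ_of_le hB),
      Finset.sum_mul_sum, mul_comm, Finset.sum_mul_sum, ← sub_eq_zero,
      ← Finset.sum_sub_distrib] at hσ
    rw [Finset.sum_product, ← hσ]
    refine Finset.sum_congr rfl fun i _ => ?_
    rw [← Finset.sum_sub_distrib]
    refine Finset.sum_congr rfl fun l _ => ?_
    simp only [Algebra.smul_def, map_sub, map_mul, ← pow_mul, mul_pow]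
    rw [mul_comm N i, mul_comm N l]
    ring
  obtain ⟨⟨i, l⟩, hil, hne, hp⟩ := hCS.exists_other _
    (fun p : ℕ × ℕ => σ u ^ p.1 * u ^ p.2) _ (by simp)
    (fun p _ => mul_ne_zero (pow_ne_zero _ hσ0) (pow_ne_zero _ hu0)) hsum (d, 0)
    (by simp) hAB
  simp only [Finset.mem_product, Finset.mem_range] at hil
  simp only [pow_zero, mul_one] at hp
  obtain ⟨c, hc, hcc⟩ := hp
  have hsplit : σ u ^ d = σ u ^ i * σ u ^ (d - i) := by rw [← pow_add]; congr 1; omega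
  have hrel : u ^ l = algebraMap C L c * σ u ^ (d - i) := by
    apply mul_left_cancel₀ (pow_ne_zero i hσ0)
    rw [hcc, hsplit]; ring
  have hprop : PropTo C (u ^ l) (σ u ^ (d - i)) := PropTo.symm ⟨c, hc, hrel⟩
  have hα : 1 ≤ d - i := by
    by_contra h
    have h0 : d - i = 0 := by omega
    rw [h0, pow_zero] at hprop
    have := PropTo.pow_eq hu (m := l) (m' := 0) (by simpa using hprop)
    apply hne
    ext <;> simp <;> omega
  refine ⟨d - i, l, hα, by omega, ?_, by omega, hprop⟩
  by_contra h
  have h0 : l = 0 := by omega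
  rw [h0, pow_zero] at hprop
  have := PropTo.pow_eq hσu (m := 0) (m' := d - i) (by simpa using hprop)
  omega


/-- The points `g` and `g + 1`. -/
def spt {L : Type*} [Field L] (p : L × Bool) : L := p.1 + (if p.2 then 1 else 0)

section rigid

variable {C L : Type*} [Field C] [Field L] [Algebra C L]

theorem gen_not_const (G : Finset L)
    (hG : ∀ g ∈ G, g ∉ IntermediateField.adjoin C ((G : Set L) \ {g}))
    (g : L) (hg : g ∈ G) (c : C) : g ≠ algebraMap C L c := by
  rintro rfl
  exact hG _ hg (IntermediateField.algebraMap_mem _ c)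

theorem gen_not_affine (G : Finset L)
    (hG : ∀ g ∈ G, g ∉ IntermediateField.adjoin C ((G : Set L) \ {g}))
    (g h : L) (hg : g ∈ G) (hh : h ∈ G) (hgh : g ≠ h) (a b : C) :
    g ≠ algebraMap C L a + algebraMap C L b * h := by
  intro he
  apply hG g hg
  rw [he]
  refine add_mem (IntermediateField.algebraMap_mem _ a)
    (mul_mem (IntermediateField.algebraMap_mem _ b) ?_)
  rw [← he]
  exact IntermediateField.subset_adjoin _ _ ⟨hh, fun h' => hgh h'.symm⟩

/-- an affine relation between two generators is trivial -/
theorem gen_rel (G : Finset L)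
    (hG : ∀ g ∈ G, g ∉ IntermediateField.adjoin C ((G : Set L) \ {g}))
    (g h : L) (hg : g ∈ G) (hh : h ∈ G) (a b c : C) (ha : a ≠ 0)
    (hrel : algebraMap C L a * g = algebraMap C L b * h + algebraMap C L c) :
    g = h ∧ a = b ∧ c = 0 := by
  have ha' : algebraMap C L a ≠ 0 := (map_ne_zero _).mpr ha
  have hgh : g = h := by
    by_contra hne
    refine gen_not_affine G hG g h hg hh hne (c / a) (b / a) ?_
    rw [map_div₀, map_div₀]
    field_simp
    rw [mul_comm, hrel]; ring
  subst hgh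
  have hab : a = b := by
    by_contra hne
    have hab' : algebraMap C L (a - b) ≠ 0 := (map_ne_zero _).mpr (sub_ne_zero.mpr hne)
    refine gen_not_const G hG g hg (c / (a - b)) ?_
    rw [map_div₀, eq_div_iff hab', map_sub]
    linear_combination hrel
  subst hab
  refine ⟨rfl, rfl, ?_⟩
  have : algebraMap C L c = 0 := by linear_combination -hrel
  exact (map_eq_zero _).mp this

theorem spt_ne_zero (G : Finset L)
    (hG : ∀ g ∈ G, g ∉ IntermediateField.adjoin C ((G : Set L) \ {g}))
    (p : L × Bool) (hp : p.1 ∈ G) : spt p ≠ 0 := by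
  intro h
  rcases p with ⟨g, b⟩
  cases b
  · exact gen_not_const G hG g hp 0 (by simpa [spt] using h)
  · refine gen_not_const G hG g hp (-1) ?_
    simp only [spt, if_true] at h
    rw [map_neg, map_one]; linear_combination h

theorem spt_eq (p : L × Bool) : spt p = p.1 + algebraMap C L (if p.2 then 1 else 0) := by
  unfold spt; split <;> simp

theorem spt_prop (G : Finset L)
    (hG : ∀ g ∈ G, g ∉ IntermediateField.adjoin C ((G : Set L) \ {g}))
    (p q : L × Bool) (hp : p.1 ∈ G) (hq : q.1 ∈ G)
    (h : PropTo C (spt p) (spt q)) : p = q := by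
  obtain ⟨c, hc, h⟩ := h
  rw [spt_eq (C := C), spt_eq (C := C)] at h
  obtain ⟨h1, h2, h3⟩ := gen_rel G hG q.1 p.1 hq hp 1 c
    (c * (if p.2 then 1 else 0) - (if q.2 then 1 else 0)) one_ne_zero (by
      rw [map_sub, map_mul, map_one]; linear_combination h)
  rw [← h2] at h3
  refine Prod.ext h1.symm ?_
  rcases p with ⟨g, b⟩
  rcases q with ⟨g', b'⟩
  cases b <;> cases b' <;> simp at h3 ⊢

theorem spt_not_const (G : Finset L)
    (hG : ∀ g ∈ G, g ∉ IntermediateField.adjoin C ((G : Set L) \ {g}))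
    (p : L × Bool) (hp : p.1 ∈ G) : ¬ PropTo C (spt p) 1 := by
  intro h
  obtain ⟨c, hc, h⟩ := h.symm
  rw [spt_eq (C := C)] at h
  refine gen_not_const G hG p.1 hp (c - (if p.2 then 1 else 0)) ?_
  rw [map_sub]; linear_combination h

theorem weighted_not_const (G : Finset L)
    (hG : ∀ g ∈ G, g ∉ IntermediateField.adjoin C ((G : Set L) \ {g}))
    [CharZero C] (hGne : G.Nonempty) (a : L × Bool → ℕ) (ha : ∀ p, 0 < a p)
    (M : ℕ) (hCS : CSAt C L (Bool × L × Bool) (4 * G.card + 1) M)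
    (c : C) : ∑ p ∈ G ×ˢ (Finset.univ : Finset Bool), (a p : L) * spt p ^ M ≠ algebraMap C L c := by
  classical
  intro h
  obtain ⟨g, hg⟩ := hGne
  set S := G ×ˢ (Finset.univ : Finset Bool) with hS
  set s : Finset (Bool × L × Bool) :=
    insert (false, 0, false) (S.image fun p => (true, p)) with hs
  set z : Bool × L × Bool → L := fun i => if i.1 then spt i.2 else 1 with hz
  have hmem : ∀ i ∈ s, i = (false, 0, false) ∨ ∃ p, p.1 ∈ G ∧ i = (true, p) := by
    intro i hi
    rw [hs, Finset.mem_insert, Finset.mem_image] at hi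
    rcases hi with hi | ⟨p, hp, rfl⟩
    · exact Or.inl hi
    · exact Or.inr ⟨p, (Finset.mem_product.mp hp).1, rfl⟩
  have g1 : s.card ≤ 4 * G.card + 1 := by
    refine (Finset.card_insert_le _ _).trans ?_
    have h1 : (S.image fun p => (true, p)).card ≤ S.card := Finset.card_image_le
    have h2 : S.card = G.card * 2 := by simp [hS]
    omega
  have g2 : ∀ i ∈ s, z i ≠ 0 := by
    intro i hi
    rcases hmem i hi with rfl | ⟨p, hpG, rfl⟩
    · simp [hz]
    · simpa [hz] using spt_ne_zero G hG p hpG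
  have g3 : ∑ i ∈ s, algebraMap C L (if i.1 then (a i.2 : C) else - c) * z i ^ M = 0 := by
    rw [hs, Finset.sum_insert (by simp), Finset.sum_image (by simp)]
    simp only [hz, if_true, map_natCast]
    rw [h]
    simp
  have g4 : (true, g, false) ∈ s := by
    rw [hs]
    refine Finset.mem_insert_of_mem (Finset.mem_image_of_mem _ ?_)
    simp [hS, hg]
  obtain ⟨i', hi', hne, hp⟩ := hCS.exists_other s z
    (fun i => if i.1 then (a i.2 : C) else - c) g1 g2 g3 (true, g, false) g4 (by
      have := (ha (g, false)).ne'
      simpa using this)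
  rcases hmem i' hi' with rfl | ⟨p, hpG, rfl⟩
  · exact spt_not_const G hG (g, false) hg (by simpa [hz] using hp)
  · apply hne
    have := spt_prop G hG (g, false) p hg hpG (by simpa [hz] using hp)
    rw [← this]

theorem sigma_rigid (G : Finset L)
    (hG : ∀ g ∈ G, g ∉ IntermediateField.adjoin C ((G : Set L) \ {g}))
    [CharZero C] (a : L × Bool → ℕ) (ha : ∀ p, 0 < a p)
    (hinj : Set.InjOn a (G ×ˢ (Finset.univ : Finset Bool) : Finset (L × Bool)))
    (M : ℕ) (hM : Even M) (hCS : CSAt C L (Bool × L × Bool) (4 * G.card + 1) M)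
    (σ : L ≃ₐ[C] L) (u : L)
    (hu : u = ∑ p ∈ G ×ˢ (Finset.univ : Finset Bool), (a p : L) * spt p ^ M)
    (hσ : PropTo C u (σ u)) : ∀ g ∈ G, σ g = g := by
  classical
  obtain ⟨c, hc, hσ⟩ := hσ
  set S := G ×ˢ (Finset.univ : Finset Bool) with hS
  have hSG : ∀ p, p ∈ S ↔ p.1 ∈ G := by intro p; simp [hS]
  set s : Finset (Bool × L × Bool) := (Finset.univ : Finset Bool) ×ˢ S with hs
  set z : Bool × L × Bool → L := fun i => if i.1 then σ (spt i.2) else spt i.2 with hz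
  set w : Bool × L × Bool → C := fun i => if i.1 then (a i.2 : C) else - (c * a i.2) with hw
  have hcard : s.card ≤ 4 * G.card + 1 := by
    rw [hs, hS, Finset.card_product, Finset.card_product]
    simp; omega
  have hsm : ∀ i, i ∈ s ↔ i.2.1 ∈ G := by intro i; rw [hs, Finset.mem_product, hSG]; simp
  have hne : ∀ i ∈ s, z i ≠ 0 := by
    rintro ⟨b, p⟩ hi
    have := spt_ne_zero G hG p ((hsm _).mp hi)
    cases b <;> simp [hz, this]
  have hsum : ∑ i ∈ s, algebraMap C L (w i) * z i ^ M = 0 := by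
    rw [hs, Finset.sum_product, Fintype.sum_bool]
    simp only [hz, hw, if_true, map_natCast, map_neg, map_mul, Bool.false_eq_true, if_false]
    have h1 : σ u = ∑ p ∈ S, (a p : L) * σ (spt p) ^ M := by
      rw [hu, map_sum]; simp
    have h2 : algebraMap C L c * u = ∑ p ∈ S, algebraMap C L c * (a p) * spt p ^ M := by
      rw [hu, Finset.mul_sum]
      exact Finset.sum_congr rfl fun _ _ => by ring
    rw [← h1]
    simp only [neg_mul, Finset.sum_neg_distrib]
    rw [← h2, hσ]; ring
  have hσprop : ∀ p q : L × Bool, p.1 ∈ G → q.1 ∈ G →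
      PropTo C (σ (spt p)) (σ (spt q)) → p = q := by
    intro p q hp hq h
    have := h.map σ.symm
    rw [AlgEquiv.symm_apply_apply, AlgEquiv.symm_apply_apply] at this
    exact spt_prop G hG p q hp hq this
  -- matching
  have hmatch : ∀ p, p.1 ∈ G → ∃ q, q.1 ∈ G ∧ ∃ e : C, e ≠ 0 ∧
      σ (spt p) = algebraMap C L e * spt q ∧ (a p : C) * e ^ M = c * a q := by
    intro p hp
    obtain ⟨⟨b, q⟩, hi', hne', hpr⟩ := hCS.exists_other s z w hcard hne hsum (true, p)
      ((hsm _).mpr hp) (by simpa [hw] using (ha p).ne')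
    have hq : q.1 ∈ G := (hsm _).mp hi'
    cases b with
    | true =>
      exfalso
      apply hne'
      rw [hσprop p q hp hq (by simpa [hz] using hpr)]
    | false =>
      have h2 := hCS.two_terms s z w hcard hne hsum (true, p) (false, q) ((hsm _).mpr hp) hi'
        (by simp) hpr (by
          rintro ⟨b', q'⟩ hl hpl
          have hq' : q'.1 ∈ G := (hsm _).mp hl
          cases b' with
          | true =>
            left
            rw [hσprop p q' hp hq' (by simpa [hz] using hpl)]
          | false =>
            right
            have h3 : PropTo C (spt q) (spt q') := by
              have := hpr.symm.trans hpl
              simpa [hz] using this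
            rw [spt_prop G hG q q' hq hq' h3])
      have hpr' : PropTo C (spt q) (σ (spt p)) := by
        have := hpr.symm
        simpa [hz] using this
      obtain ⟨e, he, hee⟩ := hpr'
      refine ⟨q, hq, e, he, hee, ?_⟩
      simp only [hz, hw, if_true, map_natCast, map_neg, map_mul, Bool.false_eq_true,
        if_false] at h2
      rw [hee, mul_pow] at h2
      have h4 : (algebraMap C L) ((a p : C) * e ^ M) = algebraMap C L (c * a q) := by
        apply mul_right_cancel₀ (pow_ne_zero M (spt_ne_zero G hG q hq))
        simp only [map_mul, map_pow, map_natCast]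
        linear_combination h2
      exact (algebraMap C L).injective h4
  choose! π hπG e he hσe hae using hmatch
  -- analysis of a pair
  have hpair : ∀ g ∈ G, e (g, false) = e (g, true) ∧
      e (g, false) * ((if (π (g, true)).2 then 1 else 0) - (if (π (g, false)).2 then 1 else 0))
        = 1 := by
    intro g hg
    have h1 := hσe (g, false) hg
    have h2 := hσe (g, true) hg
    rw [spt_eq (C := C) (π _)] at h1 h2
    simp only [spt, if_true, Bool.false_eq_true, if_false, add_zero, map_add, map_one] at h1 h2
    obtain ⟨-, h4, h5⟩ := gen_rel G hG (π (g, false)).1 (π (g, true)).1 (hπG _ hg) (hπG _ hg)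
      (e (g, false)) (e (g, true)) (e (g, true) * (if (π (g, true)).2 then 1 else 0) -
        e (g, false) * (if (π (g, false)).2 then 1 else 0) - 1) (he _ hg) (by
        simp only [map_sub, map_mul, map_one]
        linear_combination h2 - h1)
    refine ⟨h4, ?_⟩
    rw [← h4] at h5
    linear_combination h5
  have hsq : ∀ p, p.1 ∈ G → e p ^ M = 1 := by
    have h0 : ∀ g ∈ G, e (g, false) ^ 2 = 1 := by
      intro g hg
      have h2 := (hpair g hg).2
      generalize (π (g, true)).2 = b1 at h2
      generalize (π (g, false)).2 = b0 at h2
      cases b1 <;> cases b0 <;> simp at h2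
      · have : e (g, false) = -1 := by linear_combination -h2
        rw [this]; norm_num
      · rw [h2]; norm_num
    obtain ⟨m, rfl⟩ := hM
    rintro ⟨g, b⟩ hg
    rw [← two_mul, pow_mul]
    cases b
    · rw [h0 g hg, one_pow]
    · rw [← (hpair g hg).1, h0 g hg, one_pow]
  have hae' : ∀ p, p.1 ∈ G → (a p : C) = c * a (π p) := by
    intro p hp
    rw [← hae p hp, hsq p hp, mul_one]
  have hπinj : Set.InjOn π S := by
    intro p hp q hq hpq
    have hp' := (hSG p).mp hp
    have hq' := (hSG q).mp hq
    refine hσprop p q hp' hq' ?_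
    have h1 : PropTo C (spt (π p)) (σ (spt p)) := ⟨e p, he p hp', hσe p hp'⟩
    have h2 : PropTo C (spt (π q)) (σ (spt q)) := ⟨e q, he q hq', hσe q hq'⟩
    rw [← hpq] at h2
    exact h1.symm.trans h2
  have hπmaps : ∀ p ∈ S, π p ∈ S := fun p hp => (hSG _).mpr (hπG p ((hSG p).mp hp))
  have himg : S.image π = S :=
    Finset.eq_of_subset_of_card_le (Finset.image_subset_iff.mpr hπmaps)
      (by rw [Finset.card_image_of_injOn hπinj])
  intro g hg
  have hc1 : c = 1 := by
    have h1 : (∑ p ∈ S, (a p : C)) = c * ∑ p ∈ S, (a p : C) := by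
      calc (∑ p ∈ S, (a p : C)) = ∑ p ∈ S, c * (a (π p) : C) :=
            Finset.sum_congr rfl fun p hp => hae' p ((hSG p).mp hp)
        _ = c * ∑ p ∈ S, (a (π p) : C) := by rw [Finset.mul_sum]
        _ = c * ∑ p ∈ S.image π, (a p : C) := by rw [Finset.sum_image hπinj]
        _ = c * ∑ p ∈ S, (a p : C) := by rw [himg]
    have h2 : (∑ p ∈ S, (a p : C)) ≠ 0 := by
      rw [← Nat.cast_sum, Nat.cast_ne_zero]
      have : 0 < ∑ p ∈ S, a p :=
        Finset.sum_pos (fun p _ => ha p) ⟨(g, false), (hSG _).mpr hg⟩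
      exact this.ne'
    exact mul_right_cancel₀ h2 (by rw [one_mul]; exact h1.symm)
  have hπid : ∀ p, p.1 ∈ G → π p = p := by
    intro p hp
    have h1 := hae' p hp
    rw [hc1, one_mul, Nat.cast_inj] at h1
    exact (hinj ((hSG p).mpr hp) ((hSG _).mpr (hπG p hp)) h1).symm
  have h2 := (hpair g hg).2
  rw [hπid _ hg, hπid _ hg] at h2
  simp at h2
  have h3 := hσe (g, false) hg
  rw [hπid _ hg, h2] at h3
  simpa [spt] using h3

end rigid


open IntermediateField in
theorem rat_part {k K : Type*} [Field k] [Field K] [Algebra k K] (u : K) (hu : Transcendental k u)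
    (N : ℕ) (hN : 1 ≤ N) (t0 : k) :
    ∃ ε : RatFunc k →ₐ[k] K, (∀ f, ε f = Polynomial.aeval (u ^ N + algebraMap k K t0) f.num /
      Polynomial.aeval (u ^ N + algebraMap k K t0) f.denom) ∧
      ∃ hrange : ε.fieldRange ≤ IntermediateField.adjoin k {u},
        FiniteDimensional ↥ε.fieldRange ↥(IntermediateField.extendScalars hrange) ∧
        N = Module.finrank ↥ε.fieldRange ↥(IntermediateField.extendScalars hrange) := by
  set v := u ^ N + algebraMap k K t0 with hv
  have hvt : Transcendental k v := by
    intro hva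
    have h1 : IsAlgebraic k (u ^ N) := by
      have := hva.sub (isAlgebraic_algebraMap t0)
      rwa [hv, add_sub_cancel_right] at this
    exact hu (h1.of_pow (by omega))
  let ι : RatFunc k →ₐ[k] K := (IntermediateField.val _).comp
    (RatFunc.algEquivOfTranscendental u hu).toAlgHom
  let ε : RatFunc k →ₐ[k] K := (IntermediateField.val _).comp
    (RatFunc.algEquivOfTranscendental v hvt).toAlgHom
  have hε : ε.fieldRange = k⟮v⟯ := by
    ext x
    simp only [AlgHom.mem_fieldRange]
    constructor
    · rintro ⟨y, rfl⟩
      exact (RatFunc.algEquivOfTranscendental v hvt y).2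
    · intro hx
      exact ⟨(RatFunc.algEquivOfTranscendental v hvt).symm ⟨x, hx⟩, by simp [ε]⟩
  have hιX : ι RatFunc.X = u := by
    simp [ι]
  set f : RatFunc k := RatFunc.X ^ N + RatFunc.C t0 with hf
  have hιf : ι f = v := by
    rw [hf, map_add, map_pow, hιX, ← RatFunc.algebraMap_eq_C, AlgHom.commutes]
  have hrange : ε.fieldRange ≤ IntermediateField.adjoin k {u} := by
    rw [hε, adjoin_simple_le_iff]
    exact add_mem (pow_mem (mem_adjoin_simple_self k u) N) (IntermediateField.algebraMap_mem _ _)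
  have hmap : k⟮f⟯.map ι = ε.fieldRange := by
    rw [hε, adjoin_map, Set.image_singleton, hιf]
  have hfin : N = Module.finrank ↥ε.fieldRange ↥(IntermediateField.extendScalars hrange) := by
    have h1 := RatFunc.finrank_eq_max_natDegree f
    have h2 : f = algebraMap (Polynomial k) (RatFunc k) (Polynomial.X ^ N + Polynomial.C t0) := by
      simp [hf]
    rw [h2, RatFunc.num_algebraMap, RatFunc.denom_algebraMap, Polynomial.natDegree_X_pow_add_C,
      ← h2] at h1
    simp only [Polynomial.natDegree_one, Nat.max_zero] at h1
    rw [← h1]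
    let i : k⟮f⟯ ≃+* ε.fieldRange :=
      ((k⟮f⟯.equivMap ι).trans (IntermediateField.equivOfEq hmap)).toRingEquiv
    let j : RatFunc k ≃+* IntermediateField.extendScalars hrange :=
      (RatFunc.algEquivOfTranscendental u hu).toRingEquiv
    refine Algebra.finrank_eq_of_equiv_equiv i j ?_
    ext x
    rfl
  refine ⟨ε, ?_, hrange, ?_, hfin⟩
  · intro f
    exact RatFunc.algEquivOfTranscendental_apply v hvt f
  · exact Module.finite_of_finrank_pos (by omega)

theorem trans_part {k K : Type*} [Field k] [Field K] [Algebra k K]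
    (hFG : (⊤ : IntermediateField k K).FG)
    (n : ℕ) (hn : 1 ≤ n)
    (w : Fin n → K) (hw : IsTranscendenceBasis k w) (u : K) (hu : Transcendental k u) :
    ∃ y : Fin (n - 1) → K,
        AlgebraicIndependent k (Fin.cons u y : Fin (n - 1 + 1) → K) ∧
        FiniteDimensional
          ↥(IntermediateField.adjoin k (Set.range (Fin.cons u y : Fin (n - 1 + 1) → K))) K := by
  have h1 : AlgebraicIndepOn k id ({u} : Set K) := by
    have := (algebraicIndependent_unique_type_iff (R := k) (x := fun i : ({u} : Set K) => (i : K))).mpr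
      (by simpa using hu)
    exact this
  obtain ⟨t, hut, ht⟩ := exists_isTranscendenceBasis_superset h1
  have hcard := ht.lift_cardinalMk_eq hw
  have hcard' : Cardinal.mk t = n := by simpa using hcard
  have hfin : Finite t := by
    rw [← Cardinal.mk_lt_aleph0_iff, hcard']; exact Cardinal.natCast_lt_aleph0
  have hnc : Nat.card t = n := by simp [Nat.card, hcard']
  let e0 : t ≃ Fin (n - 1 + 1) := (Finite.equivFinOfCardEq hnc).trans (finCongr (by omega))
  let u' : t := ⟨u, hut rfl⟩
  let e : Fin (n - 1 + 1) ≃ t := (Equiv.swap 0 (e0 u')).trans e0.symm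
  have he : e 0 = u' := by simp [e]
  have hb : IsTranscendenceBasis k (fun i => (e i : K)) := ht.comp_equiv e
  have hcons : (Fin.cons u (fun i => (e (Fin.succ i) : K)) : Fin (n - 1 + 1) → K)
      = fun i => (e i : K) := by
    funext i
    refine Fin.cases ?_ (fun i => ?_) i
    · simp [he, u']
    · simp
  refine ⟨fun i => (e (Fin.succ i) : K), ?_, ?_⟩
  · rw [hcons]; exact hb.1
  · rw [hcons]
    set F := IntermediateField.adjoin k (Set.range fun i => (e i : K))
    have h2 : Algebra.EssFiniteType k K := IntermediateField.fg_top_iff.mp hFG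
    have h3 : Algebra.EssFiniteType F K := Algebra.EssFiniteType.of_comp k F K
    have h4 : Algebra.IsAlgebraic F K := hb.isAlgebraic_field
    exact Algebra.finite_of_essFiniteType_of_isAlgebraic


theorem exists_minimal_gens {C L : Type*} [Field C] [Field L] [Algebra C L] (G0 : Finset L)
    (h0 : IntermediateField.adjoin C (G0 : Set L) = ⊤) :
    ∃ G ⊆ G0, IntermediateField.adjoin C (G : Set L) = ⊤ ∧
      ∀ g ∈ G, g ∉ IntermediateField.adjoin C ((G : Set L) \ {g}) := by
  classical
  obtain ⟨G, hGG, hmin⟩ := exists_minimal_le_of_wellFoundedLT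
    (fun G : Finset L => IntermediateField.adjoin C (G : Set L) = ⊤) G0 h0
  refine ⟨G, hGG, hmin.1, fun g hg hmem => ?_⟩
  have h1 : IntermediateField.adjoin C ((G.erase g : Finset L) : Set L) = ⊤ := by
    rw [Finset.coe_erase, eq_top_iff, ← hmin.1, IntermediateField.adjoin_le_iff]
    intro x hx
    by_cases hxg : x = g
    · rw [hxg]; exact hmem
    · exact IntermediateField.subset_adjoin _ _ ⟨hx, hxg⟩
  have h2 := hmin.2 h1 (Finset.erase_subset g G)
  exact Finset.notMem_erase g G (h2 hg)

theorem core {C : Type*} {L : Type*} [Field C] [Field L] [Algebra C L] [CharZero C]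
    [Algebra.EssFiniteType C L] {n : ℕ} (hn : 1 ≤ n)
    (x : Fin n → L) (hx : IsTranscendenceBasis C x)
    (hcl : ∀ a : L, IsAlgebraic C a → a ∈ Set.range (algebraMap C L))
    (G0 : Finset L) (h0 : IntermediateField.adjoin C (G0 : Set L) = ⊤)
    (d0 d : ℕ) (hd0 : 1 ≤ d0) :
    ∃ u ∈ Subring.closure (G0 : Set L), Transcendental C u ∧ ∃ N, 1 ≤ N ∧ d ≤ N ∧
      ∀ A B : Polynomial C, A.natDegree ≤ d0 → B.natDegree ≤ d0 →
        A.coeff d0 * B.coeff 0 - A.coeff 0 * B.coeff d0 ≠ 0 →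
        ∀ σ : L ≃ₐ[C] L,
          σ (Polynomial.aeval (u ^ N) A / Polynomial.aeval (u ^ N) B) =
            Polynomial.aeval (u ^ N) A / Polynomial.aeval (u ^ N) B → ∀ z, σ z = z := by
  classical
  obtain ⟨G, hGG, hGtop, hG⟩ := exists_minimal_gens G0 h0
  have hGne : G.Nonempty := by
    rw [Finset.nonempty_iff_ne_empty]
    rintro rfl
    rw [Finset.coe_empty, IntermediateField.adjoin_empty] at hGtop
    have h1 : x ⟨0, hn⟩ ∈ (⊥ : IntermediateField C L) := by rw [hGtop]; trivial
    obtain ⟨c, hc⟩ := IntermediateField.mem_bot.mp h1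
    exact hx.1.transcendental ⟨0, hn⟩ (hc ▸ isAlgebraic_algebraMap c)
  obtain ⟨N1, hN1⟩ := class_sum hn x hx hcl (Bool × L × Bool) (4 * G.card + 1)
  obtain ⟨N2, hN2⟩ := class_sum hn x hx hcl (ℕ × ℕ) ((d0 + 1) * (d0 + 1))
  set S := G ×ˢ (Finset.univ : Finset Bool) with hS
  obtain ⟨a, ha, hinj⟩ : ∃ a : L × Bool → ℕ, (∀ p, 0 < a p) ∧ Set.InjOn a (S : Set (L × Bool)) := by
    refine ⟨fun p => if h : p ∈ S then S.equivFin ⟨p, h⟩ + 1 else 1, ?_, ?_⟩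
    · intro p; dsimp only; split_ifs <;> omega
    · intro p hp q hq hpq
      have hp' : p ∈ S := hp
      have hq' : q ∈ S := hq
      simp only [hp', hq', dif_pos, add_left_inj] at hpq
      have := S.equivFin.injective (Fin.ext hpq)
      simpa using this
  set M := 2 * (N1 + 1) with hM
  have hCS1 : CSAt C L (Bool × L × Bool) (4 * G.card + 1) M := hN1 M (by omega)
  set u : L := ∑ p ∈ S, (a p : L) * spt p ^ M with hu
  have huC : Transcendental C u := by
    intro hua
    obtain ⟨c, hc⟩ := hcl u hua
    exact weighted_not_const G hG hGne a ha M hCS1 c hc.symm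
  refine ⟨u, ?_, huC, N2 + d + 1, by omega, by omega, ?_⟩
  · rw [hu]
    refine sum_mem fun p hp => mul_mem (natCast_mem _ _) (pow_mem ?_ _)
    have hpG : p.1 ∈ G := by
      have := hp; rw [hS, Finset.mem_product] at this; exact this.1
    unfold spt
    refine add_mem (Subring.subset_closure (hGG hpG)) ?_
    split_ifs
    · exact one_mem _
    · exact zero_mem _
  set N := N2 + d + 1 with hN
  have hCS2 : CSAt C L (ℕ × ℕ) ((d0 + 1) * (d0 + 1)) N := hN2 N (by omega)
  intro A B hA hB hAB σ hσ
  have huN : Transcendental C (u ^ N) := fun h => huC (h.of_pow (by omega))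
  have hB0 : Polynomial.aeval (u ^ N) B ≠ 0 := by
    intro h
    apply huN
    refine ⟨B, ?_, h⟩
    rintro rfl
    simp at hAB
  have hfix : ∀ r : ℕ, (σ ^ r) (Polynomial.aeval (u ^ N) A / Polynomial.aeval (u ^ N) B) =
      Polynomial.aeval (u ^ N) A / Polynomial.aeval (u ^ N) B := by
    intro r
    induction r with
    | zero => rfl
    | succ r ih => rw [pow_succ, AlgEquiv.mul_apply, hσ, ih]
  have hprop : PropTo C u (σ u) := by
    refine prop_of_power_relations hcl u huC σ d0 fun r => ?_
    refine power_relation u huC d0 N hd0 hCS2 A B hA hB hAB (σ ^ r) ?_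
    have h1 := hfix r
    have h2 : ∀ P : Polynomial C, (σ ^ r) (Polynomial.aeval (u ^ N) P) =
        Polynomial.aeval ((σ ^ r) u ^ N) P := by
      intro P
      rw [← map_pow, Polynomial.aeval_algEquiv]; rfl
    have hB1 : Polynomial.aeval ((σ ^ r) u ^ N) B ≠ 0 := by
      rw [← h2]; exact (map_ne_zero _).mpr hB0
    rw [map_div₀, h2, h2, div_eq_div_iff hB1 hB0] at h1
    exact h1
  have hrig := sigma_rigid G hG a ha hinj M ⟨N1 + 1, by omega⟩ hCS1 σ u hu hprop
  intro z
  have hz : z ∈ IntermediateField.adjoin C (G : Set L) := by rw [hGtop]; trivial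
  induction hz using IntermediateField.adjoin_induction with
  | mem x hx => exact hrig x hx
  | algebraMap c => exact σ.commutes c
  | add x y _ _ hx hy => rw [map_add, hx, hy]
  | inv x _ hx => rw [map_inv₀, hx]
  | mul x y _ _ hx hy => rw [map_mul, hx, hy]


theorem taylor_top {k : Type*} [Field k] (A : Polynomial k) (t0 : k) (d0 : ℕ)
    (h : A.natDegree ≤ d0) : (Polynomial.taylor t0 A).coeff d0 = A.coeff d0 := by
  rcases h.eq_or_lt with rfl | h
  · rw [Polynomial.coeff_taylor_natDegree]; rfl
  · rw [Polynomial.coeff_eq_zero_of_natDegree_lt h,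
      Polynomial.coeff_eq_zero_of_natDegree_lt (by rwa [Polynomial.natDegree_taylor])]

theorem poly_part {k : Type*} [Field k] [CharZero k] (j : RatFunc k)
    (hj : j ∉ Set.range (algebraMap k (RatFunc k))) :
    ∃ d0 : ℕ, 1 ≤ d0 ∧ ∃ t0 : k,
      (Polynomial.taylor t0 j.num).natDegree ≤ d0 ∧ (Polynomial.taylor t0 j.denom).natDegree ≤ d0 ∧
      (Polynomial.taylor t0 j.num).coeff d0 * (Polynomial.taylor t0 j.denom).coeff 0 -
        (Polynomial.taylor t0 j.num).coeff 0 * (Polynomial.taylor t0 j.denom).coeff d0 ≠ 0 := by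
  set A := j.num with hA
  set B := j.denom with hB
  have hB0 : B ≠ 0 := j.denom_ne_zero
  set d0 := max A.natDegree B.natDegree with hd0
  have hAd : A.natDegree ≤ d0 := le_max_left _ _
  have hBd : B.natDegree ≤ d0 := le_max_right _ _
  set P := Polynomial.C (A.coeff d0) * B - Polynomial.C (B.coeff d0) * A with hP
  have hP0 : P ≠ 0 := by
    intro h
    rw [hP, sub_eq_zero] at h
    by_cases hb : B.coeff d0 = 0
    · have hlt : B.natDegree < d0 := by
        refine lt_of_le_of_ne hBd fun he => ?_
        rw [← he] at hb
        exact hB0 (Polynomial.leadingCoeff_eq_zero.mp hb)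
      have hAe : A.natDegree = d0 := by
        rcases max_choice A.natDegree B.natDegree with h' | h' <;> omega
      rw [hb, Polynomial.C_0, zero_mul] at h
      rcases mul_eq_zero.mp h with h | h
      · rw [Polynomial.C_eq_zero, ← hAe] at h
        have : A = 0 := Polynomial.leadingCoeff_eq_zero.mp h
        rw [this, Polynomial.natDegree_zero] at hAe
        omega
      · exact hB0 h
    · apply hj
      refine ⟨A.coeff d0 / B.coeff d0, ?_⟩
      have h' := congrArg (algebraMap (Polynomial k) (RatFunc k)) h
      simp only [map_mul, RatFunc.algebraMap_C] at h'
      have hBr : algebraMap (Polynomial k) (RatFunc k) B ≠ 0 := RatFunc.algebraMap_ne_zero hB0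
      have hbr : RatFunc.C (B.coeff d0) ≠ 0 := (map_ne_zero _).mpr hb
      rw [← RatFunc.num_div_denom j, RatFunc.algebraMap_eq_C, map_div₀, div_eq_div_iff hbr hBr, h',
        mul_comm]
  obtain ⟨t0, ht0⟩ : ∃ t0, P.eval t0 ≠ 0 := by
    by_contra! hcon
    exact hP0 (Polynomial.funext fun r => by simpa using hcon r)
  refine ⟨d0, ?_, t0, ?_, ?_, ?_⟩
  · by_contra hlt
    have hz : d0 = 0 := by omega
    apply hP0
    rw [hP, Polynomial.eq_C_of_natDegree_eq_zero (p := A) (by omega),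
      Polynomial.eq_C_of_natDegree_eq_zero (p := B) (by omega), hz]
    simp [mul_comm]
  · rwa [Polynomial.natDegree_taylor]
  · rwa [Polynomial.natDegree_taylor]
  · rw [taylor_top _ _ _ hAd, taylor_top _ _ _ hBd, Polynomial.taylor_coeff_zero,
      Polynomial.taylor_coeff_zero]
    rw [hP] at ht0
    simp only [Polynomial.eval_sub, Polynomial.eval_mul, Polynomial.eval_C] at ht0
    rwa [mul_comm (A.eval t0)]

theorem abstract_main {k K L : Type*} [Field k] [Field K] [Field L] [CharZero k]
    [Algebra k K] [Algebra K L] [Algebra k L] [IsScalarTower k K L]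
    (hgen : IntermediateField.adjoin K {z : L | IsAlgebraic k z} = ⊤)
    (hFG : (⊤ : IntermediateField k K).FG)
    (n : ℕ) (hn : 1 ≤ n)
    (w : Fin n → K) (hw : IsTranscendenceBasis k w)
    (j : RatFunc k) (hj : j ∉ Set.range (algebraMap k (RatFunc k)))
    (d : ℕ) :
    ∃ u : K, Transcendental k u ∧ ∃ N : ℕ, 1 ≤ N ∧ d ≤ N ∧ ∃ t0 : k,
      ∀ σ : L ≃+* L, (∀ z, IsAlgebraic k z → σ z = z) →
        σ (algebraMap K L (Polynomial.aeval (u ^ N + algebraMap k K t0) j.num /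
          Polynomial.aeval (u ^ N + algebraMap k K t0) j.denom)) =
          algebraMap K L (Polynomial.aeval (u ^ N + algebraMap k K t0) j.num /
          Polynomial.aeval (u ^ N + algebraMap k K t0) j.denom) → ∀ z, σ z = z := by
  classical
  obtain ⟨d0, hd0, t0, hA, hB, hAB⟩ := poly_part j hj
  let C := algebraicClosure k L
  have hCmem : ∀ z : L, z ∈ C ↔ IsAlgebraic k z := fun z => mem_algebraicClosure_iff
  have hKL : Algebra.IsAlgebraic K L := by
    rw [← algebraicClosure.eq_top_iff, eq_top_iff, ← hgen, IntermediateField.adjoin_le_iff]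
    intro z hz
    have hz' : IsAlgebraic k z := hz
    exact mem_algebraicClosure_iff.mpr (hz'.tower_top K)
  have hx : IsTranscendenceBasis C (algebraMap K L ∘ w) :=
    (Algebra.IsAlgebraic.isTranscendenceBasis_iff k C).mp hw.algebraMap_comp
  have hcl : ∀ a : L, IsAlgebraic C a → a ∈ Set.range (algebraMap C L) := by
    intro a ha
    exact ⟨⟨a, (hCmem a).mpr (ha.restrictScalars k)⟩, rfl⟩
  obtain ⟨s, hs⟩ := hFG
  let G0 : Finset L := s.image (algebraMap K L)
  have hKmem : ∀ z : K, algebraMap K L z ∈ IntermediateField.adjoin C (G0 : Set L) := by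
    intro z
    have hz : z ∈ IntermediateField.adjoin k (s : Set K) := by rw [hs]; trivial
    induction hz using IntermediateField.adjoin_induction with
    | mem x hx =>
      exact IntermediateField.subset_adjoin _ _ (Finset.mem_image_of_mem _ hx)
    | algebraMap c =>
      rw [← IsScalarTower.algebraMap_apply, IsScalarTower.algebraMap_apply k C L]
      exact IntermediateField.algebraMap_mem _ _
    | add x y _ _ hx hy => rw [map_add]; exact add_mem hx hy
    | inv x _ hx => rw [map_inv₀]; exact inv_mem hx
    | mul x y _ _ hx hy => rw [map_mul]; exact mul_mem hx hy
  have h0 : IntermediateField.adjoin C (G0 : Set L) = ⊤ := by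
    rw [eq_top_iff]
    rintro z -
    have hz : z ∈ IntermediateField.adjoin K {z : L | IsAlgebraic k z} := by rw [hgen]; trivial
    induction hz using IntermediateField.adjoin_induction with
    | mem x hx =>
      exact IntermediateField.algebraMap_mem _ (⟨x, (hCmem x).mpr hx⟩ : C)
    | algebraMap c => exact hKmem c
    | add x y _ _ hx hy => exact add_mem hx hy
    | inv x _ hx => exact inv_mem hx
    | mul x y _ _ hx hy => exact mul_mem hx hy
  have : Algebra.EssFiniteType C L := IntermediateField.fg_top_iff.mp ⟨G0, h0⟩
  have : CharZero C := charZero_of_injective_algebraMap (algebraMap k C).injective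
  obtain ⟨u, huG, huC, N, hN1, hNd, hmain⟩ := core hn _ hx hcl G0 h0 d0 d hd0
  obtain ⟨u, rfl⟩ : ∃ u0 : K, algebraMap K L u0 = u := by
    have h1 : Subring.closure (G0 : Set L) ≤ (algebraMap K L).range := by
      rw [Subring.closure_le]
      intro z hz
      obtain ⟨y, -, rfl⟩ := Finset.mem_image.mp (Finset.mem_coe.mp hz)
      exact ⟨y, rfl⟩
    exact h1 huG
  refine ⟨u, ?_, N, hN1, hNd, t0, ?_⟩
  · intro hua
    have h1 : IsAlgebraic k (algebraMap K L u) := hua.algebraMap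
    exact huC (h1.tower_top C)
  intro σ hσ hσj
  let τ : L ≃ₐ[C] L := AlgEquiv.ofRingEquiv (f := σ) (fun c => hσ _ ((hCmem _).mp c.2))
  have hA' : ∀ P : Polynomial k, Polynomial.aeval (algebraMap K L u ^ N)
      ((Polynomial.taylor t0 P).map (algebraMap k C)) =
      algebraMap K L (Polynomial.aeval (u ^ N + algebraMap k K t0) P) := by
    intro P
    rw [Polynomial.aeval_map_algebraMap, ← map_pow, Polynomial.aeval_algebraMap_apply,
      Polynomial.taylor_apply, Polynomial.aeval_comp]
    simp
  have hinj := (algebraMap k C).injective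
  refine fun z => hmain ((Polynomial.taylor t0 j.num).map (algebraMap k C))
    ((Polynomial.taylor t0 j.denom).map (algebraMap k C)) ?_ ?_ ?_ τ ?_ z
  · rwa [Polynomial.natDegree_map]
  · rwa [Polynomial.natDegree_map]
  · simp only [Polynomial.coeff_map]
    rw [← map_mul, ← map_mul, ← map_sub]
    exact (map_ne_zero _).mpr hAB
  · rw [hA', hA', ← map_div₀]
    exact hσj


/-!
STATEMENT 8: Let `k` be a field of characteristic zero and `K` a finitely generated
field extension of `k` of transcendence degree `n ≥ 1` (witnessed by a transcendence
basis `w : Fin n → K`) such that `k` is relatively algebraically closed in `K`.  Let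
`j ∈ k(t)` with `j ∉ k` and let `d ≥ 1`.  Then there exist: `u ∈ K` transcendental
over `k`; a `k`-embedding `ε : k(t) → K` with image contained in `k(u)` such that the
degree `[k(u) : ε(k(t))]` is finite and at least `d`; and elements `y₂,…,y_n ∈ K`
such that `u, y₂,…,y_n` are algebraically independent over `k` and `K` is finite over
`E = k(u,y₂,…,y_n)`; with the property: fixing an algebraic closure `Ω` of `K` and
letting `k̄` be the relative algebraic closure of `k` in `Ω`, every field
automorphism of the compositum `k̄·K` fixing the compositum `k̄·k(ε(j))` pointwise is
the identity. -/
theorem stmt8 (k K Ω : Type*) [Field k] [Field K] [Field Ω] [CharZero k]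
    [Algebra k K] [Algebra K Ω] [Algebra k Ω] [IsScalarTower k K Ω] [IsAlgClosure K Ω]
    (hFG : (⊤ : IntermediateField k K).FG)
    (n : ℕ) (hn : 1 ≤ n)
    (w : Fin n → K) (hw : IsTranscendenceBasis k w)
    (hrelclosed : ∀ a : K, IsAlgebraic k a → ∃ b : k, algebraMap k K b = a)
    (j : RatFunc k) (hj : j ∉ Set.range (algebraMap k (RatFunc k)))
    (d : ℕ) (hd : 1 ≤ d) :
    ∃ u : K, Transcendental k u ∧
    ∃ ε : RatFunc k →ₐ[k] K,
    ∃ hrange : ε.fieldRange ≤ IntermediateField.adjoin k {u},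
      FiniteDimensional ↥ε.fieldRange ↥(IntermediateField.extendScalars hrange) ∧
      d ≤ Module.finrank ↥ε.fieldRange ↥(IntermediateField.extendScalars hrange) ∧
      ∃ y : Fin (n - 1) → K,
        AlgebraicIndependent k (Fin.cons u y) ∧
        FiniteDimensional
          ↥(IntermediateField.adjoin k (Set.range (Fin.cons u y))) K ∧
        ∀ σ : ↥(IntermediateField.adjoin K {z : Ω | IsAlgebraic k z}) ≃+*
              ↥(IntermediateField.adjoin K {z : Ω | IsAlgebraic k z}),
          (∀ z : ↥(IntermediateField.adjoin K {z : Ω | IsAlgebraic k z}),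
              (z : Ω) ∈ Subfield.closure
                ({z : Ω | IsAlgebraic k z} ∪
                  (algebraMap K Ω '' (IntermediateField.adjoin k {ε j} : Set K))) →
              σ z = z) →
          σ = RingEquiv.refl _ := by
  have hgen : IntermediateField.adjoin K
      {z : ↥(IntermediateField.adjoin K {z : Ω | IsAlgebraic k z}) | IsAlgebraic k z} = ⊤ := by
    set S : Set Ω := {z : Ω | IsAlgebraic k z} with hS
    set M := IntermediateField.adjoin K S with hM
    apply IntermediateField.map_injective M.val
    rw [IntermediateField.adjoin_map, ← AlgHom.fieldRange_eq_map, IntermediateField.fieldRange_val,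
      hM]
    congr 1
    ext z
    constructor
    · rintro ⟨y, hy, rfl⟩
      have hy' : IsAlgebraic k y := hy
      exact (isAlgebraic_algHom_iff (M.val.restrictScalars k) M.val.injective).mpr hy'
    · intro hz
      refine ⟨⟨z, IntermediateField.subset_adjoin _ _ hz⟩, ?_, rfl⟩
      exact (isAlgebraic_algHom_iff (M.val.restrictScalars k) M.val.injective).mp hz
  obtain ⟨u, hu, N, hN1, hNd, t0, hmain⟩ := abstract_main hgen hFG n hn w hw j hj d
  obtain ⟨ε, hε, hrange, hfd, hfr⟩ := rat_part u hu N hN1 t0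
  obtain ⟨y, hy1, hy2⟩ := trans_part hFG n hn w hw u hu
  refine ⟨u, hu, ε, hrange, hfd, hfr ▸ hNd, y, hy1, hy2, ?_⟩
  intro σ hσ
  refine RingEquiv.ext fun z => ?_
  refine hmain σ ?_ ?_ z
  · intro z hz
    refine hσ z (Subfield.subset_closure (Or.inl ?_))
    exact hz.algHom ((IntermediateField.val _).restrictScalars k)
  · rw [← hε]
    refine hσ _ (Subfield.subset_closure (Or.inr ⟨ε j, ?_, rfl⟩))
    exact IntermediateField.mem_adjoin_simple_self k (ε j)
end
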